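/- arXiv:2405.20276 — 3 statements merged into one kernel-verified Lean document; each statement's English description precedes it below -/
import Mathlib

section
/- Let (G,o) be a sourced Eulerian digraph and suppose μ is a proper Gibbs measure on Eulerian paths from o to ∞ in G. Then μ is the law of the path produced by the following procedure: sample a random spanning in-arboretum A of G rooted at infinity with law WUA_G (e.g. via Wilson's algorithm rooted at infinity); for each vertex v, conditionally independently given A, choose a uniformly random ordering of the edges pointing out of v that do not belong to A; form the stack configuration at each vertex v whose list consists of these edges in the chosen random order followed by the edge of A pointing out of v at the bottom; and follow the stacks starting from o (repeatedly cross and delete the edge at the front of the list at the current vertex). -/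
open MeasureTheory Filter Set
open scoped ENNReal

namespace DF

/-! ### Sequences over a countable state space -/

variable {S : Type}

/-- The number of transitions from `u` to `v` among the first `n` steps of the sequence `x`. -/
noncomputable def transCount (x : ℕ → S) (n : ℕ) (u v : S) : ℕ :=
  Set.ncard {i : ℕ | i < n ∧ x i = u ∧ x (i + 1) = v}

/-- The equivalence `(x₀,…,xₙ) ≃ (y₀,…,yₙ)` of finite sequences: same initial state and the same
transition counts between every ordered pair of states. -/
def FinEquiv (x y : ℕ → S) (n : ℕ) : Prop :=
  x 0 = y 0 ∧ ∀ u v : S, transCount x n u v = transCount y n u v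

/-- The equivalence `x ≃ y` of infinite sequences: they eventually agree and their initial
segments up to that point are `≃`-equivalent. -/
def InfEquiv (x y : ℕ → S) : Prop :=
  ∃ N : ℕ, (∀ n : ℕ, N ≤ n → x n = y n) ∧ FinEquiv x y N

/-- The transition numbers `M(u,v) = #{i ≥ 0 : (xᵢ, xᵢ₊₁) = (u,v)}` of an infinite sequence. -/
noncomputable def transNum (x : ℕ → S) (u v : S) : ℕ∞ :=
  Set.encard {i : ℕ | x i = u ∧ x (i + 1) = v}

/-- The sigma-algebra on `S^ℕ` generated by the transition numbers. -/
noncomputable def transSigma (S : Type) : MeasurableSpace (ℕ → S) :=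
  ⨆ u : S, ⨆ v : S, MeasurableSpace.comap (fun x => transNum x u v) (⊤ : MeasurableSpace ℕ∞)

/-- The tail sigma-algebra `⋂ₙ σ(Xₙ, Xₙ₊₁, …)` on `S^ℕ`. -/
def tailSigma (S : Type) [MeasurableSpace S] : MeasurableSpace (ℕ → S) :=
  ⨅ n : ℕ, MeasurableSpace.comap (fun (x : ℕ → S) (i : ℕ) => x (i + n))
    (inferInstance : MeasurableSpace (ℕ → S))

/-- A measure on `S^ℕ` is partially exchangeable if any two `≃`-equivalent finite initial
segments have the same probability. -/
def PartiallyExchangeable [MeasurableSpace S] (μ : Measure (ℕ → S)) : Prop :=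
  ∀ (n : ℕ) (x y : ℕ → S), FinEquiv x y n →
    μ {ω | ∀ i ≤ n, ω i = x i} = μ {ω | ∀ i ≤ n, ω i = y i}

/-- The set of partially exchangeable probability measures on `S^ℕ`. -/
def PEProb (S : Type) [MeasurableSpace S] : Set (Measure (ℕ → S)) :=
  {μ | μ Set.univ = 1 ∧ PartiallyExchangeable μ}

/-- `μ` is an extreme point of the convex set of partially exchangeable probability measures. -/
def IsExtremePE [MeasurableSpace S] (μ : Measure (ℕ → S)) : Prop :=
  μ ∈ PEProb S ∧
    ∀ μ₁ ∈ PEProb S, ∀ μ₂ ∈ PEProb S, ∀ t : ℝ≥0∞, 0 < t → t < 1 →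
      μ = t • μ₁ + (1 - t) • μ₂ → μ₁ = μ₂

/-! ### Digraphs -/

/-- A digraph on vertex set `V` with edge set `E`: each edge has a tail (`src`) and head (`dst`).
Multiple edges and loops are allowed. -/
structure DigraphStruct (V E : Type) where
  src : E → V
  dst : E → V

namespace DigraphStruct

variable {V E : Type} (G : DigraphStruct V E)

def outEdges (v : V) : Set E := {e | G.src e = v}

def inEdges (v : V) : Set E := {e | G.dst e = v}

noncomputable def outDeg (v : V) : ℕ := (G.outEdges v).ncard

noncomputable def inDeg (v : V) : ℕ := (G.inEdges v).ncard

def LocallyFinite : Prop := ∀ v : V, (G.outEdges v).Finite ∧ (G.inEdges v).Finite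

/-- Adjacency in the underlying undirected graph. -/
def undirAdj (u v : V) : Prop :=
  ∃ e : E, (G.src e = u ∧ G.dst e = v) ∨ (G.src e = v ∧ G.dst e = u)

/-- `G` is connected as an undirected graph. -/
def Connected : Prop := ∀ u v : V, Relation.ReflTransGen G.undirAdj u v

def dirAdj (u v : V) : Prop := ∃ e : E, G.src e = u ∧ G.dst e = v

/-- One step along an edge of the edge set `B`. -/
def step (B : Set E) (u v : V) : Prop := ∃ e ∈ B, G.src e = u ∧ G.dst e = v

/-- `(G,o)` is an infinite sourced Eulerian digraph (with sink at infinity). -/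
structure IsSourcedEulerian (o : V) : Prop where
  infinite : Infinite V
  locFin : G.LocallyFinite
  conn : G.Connected
  balanced : ∀ v : V, v ≠ o → G.inDeg v = G.outDeg v
  source : G.outDeg o = G.inDeg o + 1

/-- The reversal of `G`: head and tail of every edge are exchanged. -/
def rev : DigraphStruct V E := ⟨G.dst, G.src⟩

/-- One-step transition probability of the random walk on `G`. -/
noncomputable def stepProb (u v : V) : ℝ≥0∞ :=
  ({e : E | G.src e = u ∧ G.dst e = v}.ncard : ℝ≥0∞) / (G.outDeg u : ℝ≥0∞)

open Classical in
/-- `μ` is the law of the random walk on `G` started at `o`, characterised through its cylinder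
probabilities. -/
def IsWalkLaw [MeasurableSpace V] (o : V) (μ : Measure (ℕ → V)) : Prop :=
  μ Set.univ = 1 ∧
    ∀ (n : ℕ) (x : ℕ → V),
      μ {ω | ∀ i ≤ n, ω i = x i} =
        if x 0 = o then ∏ i ∈ Finset.range n, G.stepProb (x i) (x (i + 1)) else 0

/-- `G` is transient: from every starting point, the random walk on `G` visits every vertex at
most finitely often almost surely. -/
def TransientDigraph [MeasurableSpace V] : Prop :=
  ∀ (o : V) (μ : Measure (ℕ → V)),
    G.IsWalkLaw o μ → μ {ω | ∀ v : V, {i : ℕ | ω i = v}.Finite} = 1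

/-- An infinite path in `G` indexed by `ℕ`, encoded by its sequence of edges. -/
def IsInfPath (γ : ℕ → E) : Prop := ∀ i : ℕ, G.dst (γ i) = G.src (γ (i + 1))

/-- A transient path: it visits every vertex at most finitely often. -/
def IsTransientPath (γ : ℕ → E) : Prop := ∀ v : V, {i : ℕ | G.src (γ i) = v}.Finite

/-- The edge set of the last-exit arboretum `𝓛(γ)`: the edges crossed by `γ` as it exits their
tail for the last time. -/
def lastExitSet (γ : ℕ → E) : Set E :=
  {e | ∃ i : ℕ, γ i = e ∧ ∀ j : ℕ, i < j → G.src (γ j) ≠ G.src (γ i)}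

end DigraphStruct

/-! ### Finite paths, Eulerian paths, arborescences -/

/-- `IsPathList G o z P` means that the list of edges `P` forms a directed path from `o`
to `z` in `G`. -/
def IsPathList {V E : Type} (G : DigraphStruct V E) : V → V → List E → Prop
  | o, z, [] => o = z
  | o, z, e :: es => G.src e = o ∧ IsPathList G (G.dst e) z es

/-- `P` is an Eulerian path from `o` to `z`: a path crossing every edge exactly once. -/
def IsEulerList {V E : Type} (G : DigraphStruct V E) (o z : V) (P : List E) : Prop :=
  IsPathList G o z P ∧ P.Nodup ∧ ∀ e : E, e ∈ P

/-- `B` is (the edge set of) a spanning in-arborescence of `G` rooted at `z`. -/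
def IsFinArb {V E : Type} (G : DigraphStruct V E) (z : V) (B : Set E) : Prop :=
  (∀ e ∈ B, G.src e ≠ z) ∧
  (∀ v : V, v ≠ z → ∃! e : E, e ∈ B ∧ G.src e = v) ∧
  (∀ v : V, Relation.ReflTransGen (G.step B) v z)

/-- `(G,o,z)` is a finite Eulerian digraph with source `o` and sink `z`. -/
structure IsFinEulerian {V E : Type} (G : DigraphStruct V E) (o z : V) : Prop where
  finV : Finite V
  finE : Finite E
  reach_from : ∀ v : V, Relation.ReflTransGen G.dirAdj o v
  reach_to : ∀ v : V, Relation.ReflTransGen G.dirAdj v z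
  bal_ne : o ≠ z → (∀ v : V, v ≠ o → v ≠ z → G.inDeg v = G.outDeg v) ∧
      G.outDeg o = G.inDeg o + 1 ∧ G.inDeg z = G.outDeg z + 1
  bal_eq : o = z → ∀ v : V, G.inDeg v = G.outDeg v

/-! ### Wired uniform spanning in-arborescences -/

/-- An exhaustion of the vertex set by finite subsets. -/
def IsExhaustion {V : Type} (Vn : ℕ → Set V) : Prop :=
  (∀ n, (Vn n).Finite) ∧ (∀ n, Vn n ⊆ Vn (n + 1)) ∧ (⋃ n, Vn n) = Set.univ

/-- `B` is (the edge set of) a spanning in-arborescence of the wired graph `G_U^*`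
(all vertices outside `U` identified to a single boundary vertex) rooted at the boundary. -/
def IsWiredArb {V E : Type} (G : DigraphStruct V E) (U : Set V) (B : Set E) : Prop :=
  (∀ e ∈ B, G.src e ∈ U) ∧ (∀ v ∈ U, ∃! e : E, e ∈ B ∧ G.src e = v) ∧
  (∀ v ∈ U, ∃ v' : V, v' ∉ U ∧ Relation.ReflTransGen (G.step B) v v')

/-- The probability, under the uniform spanning in-arborescence of the wired graph `G_U^*`
rooted at the boundary, that all edges of `F` are present. -/
noncomputable def wiredUACyl {V E : Type} (G : DigraphStruct V E) (U : Set V) (F : Finset E) :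
    ℝ≥0∞ :=
  (Nat.card {B : Set E // IsWiredArb G U B ∧ (F : Set E) ⊆ B} : ℝ≥0∞) /
    (Nat.card {B : Set E // IsWiredArb G U B} : ℝ≥0∞)

/-- `κ` is the law of the wired uniform spanning in-arboretum of `G` (as a random edge set,
encoded as an element of `E → Bool`): its cylinder probabilities are the limits along any
exhaustion of the uniform spanning in-arborescence measures of the wired graphs. -/
def IsWUALaw {V E : Type} (G : DigraphStruct V E) (κ : Measure (E → Bool)) : Prop :=
  κ Set.univ = 1 ∧
    ∀ Vn : ℕ → Set V, IsExhaustion Vn → ∀ F : Finset E,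
      Filter.Tendsto (fun n => wiredUACyl G (Vn n) F) Filter.atTop
        (nhds (κ {A | ∀ e ∈ F, A e = true}))

/-- A spanning in-arboretum rooted at infinity all of whose components are one-ended:
every vertex has out-degree exactly one, and the past of every vertex is finite. -/
def IsOneEndedSpanningArb {V E : Type} (G : DigraphStruct V E) (A : Set E) : Prop :=
  (∀ v : V, ∃! e : E, e ∈ A ∧ G.src e = v) ∧
    ∀ v : V, {u : V | Relation.ReflTransGen (G.step A) u v}.Finite

/-! ### Proper Gibbs measures on Eulerian paths -/

/-- `w` is a finite path in `G` starting at `o` (encoded by its edges). -/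
def PrefixPath {V E : Type} (G : DigraphStruct V E) (o : V) {n : ℕ} (w : Fin n → E) : Prop :=
  (∀ h : 0 < n, G.src (w ⟨0, h⟩) = o) ∧
    ∀ (i : ℕ) (h : i + 1 < n), G.dst (w ⟨i, Nat.lt_of_succ_lt h⟩) = G.src (w ⟨i + 1, h⟩)

/-- A proper Gibbs measure on Eulerian paths from `o` to `∞` in `G`: a probability measure on
edge sequences, supported on half-infinite paths started at `o` crossing every edge exactly once,
such that conditionally on the steps after time `n` the first `n` steps are a uniform Eulerian
path (from `o`, in the digraph spanned by the edges not crossed after time `n`, to the position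
at time `n`). Uniformity is expressed by invariance under replacing the first `n` steps by any
other path from `o` crossing the same set of edges. -/
def ProperGibbs {V E : Type} [MeasurableSpace E] (G : DigraphStruct V E) (o : V)
    (μ : Measure (ℕ → E)) : Prop :=
  μ Set.univ = 1 ∧
  μ {γ | (∀ i : ℕ, G.dst (γ i) = G.src (γ (i + 1))) ∧ G.src (γ 0) = o ∧ Function.Bijective γ}
      = 1 ∧
  ∀ (n : ℕ) (w w' : Fin n → E), Function.Injective w → Function.Injective w' →
    Set.range w = Set.range w' → PrefixPath G o w → PrefixPath G o w' →
    ∀ B : Set (ℕ → E),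
      μ {γ | (∀ i : Fin n, γ (i : ℕ) = w i) ∧ (fun t : ℕ => γ (n + t)) ∈ B} =
        μ {γ | (∀ i : Fin n, γ (i : ℕ) = w' i) ∧ (fun t : ℕ => γ (n + t)) ∈ B}

/-! ### Loop erasure and Wilson's algorithm rooted at infinity -/

/-- The loop-erasure times of the (transient) vertex sequence `p`:
`t₀ = 0`, `tᵢ₊₁ = 1 + max {t ≥ tᵢ : p t = p tᵢ}`. -/
noncomputable def leTimes {V : Type} (p : ℕ → V) : ℕ → ℕ
  | 0 => 0
  | i + 1 => sSup {t : ℕ | leTimes p i ≤ t ∧ p t = p (leTimes p i)} + 1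

/-- The loop-erasure times of the vertex sequence `p` run up to time `k`. -/
noncomputable def leTimesF {V : Type} (p : ℕ → V) (k : ℕ) : ℕ → ℕ
  | 0 => 0
  | i + 1 => sSup {t : ℕ | leTimesF p k i ≤ t ∧ t ≤ k ∧ p t = p (leTimesF p k i)} + 1

/-- The set of vertices incident to an edge of `A`. -/
def vertsOf {V E : Type} (G : DigraphStruct V E) (A : Set E) : Set V :=
  {u | ∃ e ∈ A, G.src e = u ∨ G.dst e = u}

open Classical in
/-- The set of edges of the loop-erasure of the walk `x` (an edge sequence) stopped when it
first hits `U`; if it never hits `U`, the loop-erasure of the whole (transient) walk. -/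
noncomputable def stoppedLEedges {V E : Type} (G : DigraphStruct V E) (U : Set V) (x : ℕ → E) :
    Set E :=
  if ∃ t : ℕ, G.src (x t) ∈ U then
    {e | ∃ i : ℕ,
      leTimesF (fun t => G.src (x t)) (sInf {t : ℕ | G.src (x t) ∈ U}) i <
          sInf {t : ℕ | G.src (x t) ∈ U} ∧
        x (leTimesF (fun t => G.src (x t)) (sInf {t : ℕ | G.src (x t) ∈ U}) i) = e}
  else Set.range fun i => x (leTimes (fun t => G.src (x t)) i)

/-- The partial edge sets generated by Wilson's algorithm rooted at infinity, run with the
enumeration `v` of the vertices and with `W j` the random walk used at stage `j + 1`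
(started at `v j`). -/
noncomputable def wilsonA {V E : Type} (G : DigraphStruct V E) (v : ℕ → V) (W : ℕ → ℕ → E) :
    ℕ → Set E
  | 0 => ∅
  | j + 1 =>
      wilsonA G v W j ∪
        stoppedLEedges G (vertsOf G (wilsonA G v W j) ∪ {u | ∃ i < j, v i = u}) (W j)

open Classical in
/-- Cylinder probabilities for the random walk on `G` started at `v`, recorded as a sequence of
edges: the probability that the first `n` crossed edges are `x 0, …, x (n-1)`. -/
noncomputable def edgeWalkCyl {V E : Type} (G : DigraphStruct V E) (v : V) (x : ℕ → E) (n : ℕ) :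
    ℝ≥0∞ :=
  if (0 < n → G.src (x 0) = v) ∧ (∀ i : ℕ, i + 1 < n → G.dst (x i) = G.src (x (i + 1))) then
    ∏ i ∈ Finset.range n, ((G.outDeg (G.src (x i)) : ℝ≥0∞))⁻¹
  else 0

/-- `P` is the joint law of a sequence of independent random walks on `G`, the `j`-th walk
started at `v j`. -/
def IsIndepWalksLaw {V E : Type} [MeasurableSpace E] (G : DigraphStruct V E) (v : ℕ → V)
    (P : Measure (ℕ → ℕ → E)) : Prop :=
  P Set.univ = 1 ∧
    ∀ (m n : ℕ) (x : ℕ → ℕ → E),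
      P {ω | ∀ j < m, ∀ t < n, ω j t = x j t} =
        ∏ j ∈ Finset.range m, edgeWalkCyl G (v j) (x j) n

/-- `μ` is the law of the random walk on `G` started at `o`, recorded as its sequence of crossed
edges. -/
def IsEdgeWalkLaw {V E : Type} [MeasurableSpace E] (G : DigraphStruct V E) (o : V)
    (μ : Measure (ℕ → E)) : Prop :=
  μ Set.univ = 1 ∧ ∀ (n : ℕ) (x : ℕ → E), μ {ω | ∀ i < n, ω i = x i} = edgeWalkCyl G o x n

/-! ### Finite approximations and Gibbs measures on arboreta -/

/-- A finite digraph with vertices and edges labelled by natural numbers. -/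
structure FinDigraph where
  VS : Finset ℕ
  ES : Finset ℕ
  fsrc : ℕ → ℕ
  fdst : ℕ → ℕ

/-- `B` is a spanning in-arborescence of the finite digraph `H` rooted at `z`. -/
def FinDigraph.IsArb (H : FinDigraph) (z : ℕ) (B : Finset ℕ) : Prop :=
  B ⊆ H.ES ∧ (∀ e ∈ B, H.fsrc e ≠ z) ∧
  (∀ v ∈ H.VS, v ≠ z → ∃! e : ℕ, e ∈ B ∧ H.fsrc e = v) ∧
  (∀ v ∈ H.VS, Relation.ReflTransGen
      (fun a b => ∃ e ∈ B, H.fsrc e = a ∧ H.fdst e = b) v z)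

/-- A finite digraph `H` with a distinguished vertex `z`, together with a partial isomorphism
to a digraph on `(V, E)`: vertex and edge domains `A`, `F` in `H` and maps `φV`, `φE` to `V`, `E`. -/
structure PIso (V E : Type) where
  H : FinDigraph
  z : ℕ
  A : Finset ℕ
  F : Finset ℕ
  φV : ℕ → V
  φE : ℕ → E

/-- The data of `p` really is a partial isomorphism to `G`. -/
def PIso.Valid {V E : Type} (p : PIso V E) (G : DigraphStruct V E) : Prop :=
  ↑p.A ⊆ ↑p.H.VS ∧ ↑p.F ⊆ ↑p.H.ES ∧ p.z ∈ p.H.VS ∧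
  Set.InjOn p.φV ↑p.A ∧ Set.InjOn p.φE ↑p.F ∧
  ∀ e ∈ p.F, p.H.fsrc e ∈ p.A ∧ p.H.fdst e ∈ p.A ∧
    G.src (p.φE e) = p.φV (p.H.fsrc e) ∧ G.dst (p.φE e) = p.φV (p.H.fdst e)

/-- The partial isomorphism `p` identifies a neighbourhood of (a preimage of) `w`:
`w` is in the range of `φV` and `φE` maps the edges incident to its preimage bijectively onto
the edges incident to `w`. -/
def PIso.GoodAt {V E : Type} (p : PIso V E) (G : DigraphStruct V E) (w : V) : Prop :=
  ∃ w' ∈ p.A, p.φV w' = w ∧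
    (∀ e' ∈ p.H.ES, (p.H.fsrc e' = w' ∨ p.H.fdst e' = w') → e' ∈ p.F) ∧
    ∀ e : E, (G.src e = w ∨ G.dst e = w) →
      ∃! e' : ℕ, e' ∈ p.F ∧ (p.H.fsrc e' = w' ∨ p.H.fdst e' = w') ∧ p.φE e' = e

/-- `a` is a finite approximation to `G`: a sequence of finite digraphs with distinguished
vertices `zₙ` and partial isomorphisms to `G`, identifying larger and larger neighbourhoods of
every finite vertex set, with the distinguished vertices escaping to infinity. -/
def IsFinApproxSeq {V E : Type} (G : DigraphStruct V E) (a : ℕ → PIso V E) : Prop :=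
  (∀ n, (a n).Valid G) ∧
  (∀ W : Finset V, ∃ N, ∀ n ≥ N, ∀ w ∈ W, (a n).GoodAt G w) ∧
  (∀ W : Finset V, ∃ N, ∀ n ≥ N, ¬((a n).z ∈ (a n).A ∧ (a n).φV (a n).z ∈ (W : Set V)))

/-- The probability, under the uniform spanning in-arborescence of `p.H` rooted at `p.z`, that
every edge of `F` is in the image of the arborescence under the partial isomorphism. -/
noncomputable def pisoUACyl {V E : Type} (p : PIso V E) (F : Finset E) :
    ℝ≥0∞ :=
  (Nat.card {B : Finset ℕ // p.H.IsArb p.z B ∧ ∀ e ∈ F, ∃ e' ∈ B, e' ∈ p.F ∧ p.φE e' = e} :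
      ℝ≥0∞) /
    (Nat.card {B : Finset ℕ // p.H.IsArb p.z B} : ℝ≥0∞)

/-- `μ` (a measure on edge sets, encoded as elements of `E → Bool`) is a Gibbs measure on
spanning in-arboreta of `G` rooted at infinity: it is a weak limit of mixtures (over a random
finite approximation to `G`) of uniform spanning in-arborescence measures on finite
approximations to `G`. -/
def IsArbGibbs {V E : Type} (G : DigraphStruct V E) (μ : Measure (E → Bool)) : Prop :=
  μ Set.univ = 1 ∧
  ∃ (Ω : Type) (mΩ : MeasurableSpace Ω) (ν : @Measure Ω mΩ) (a : Ω → ℕ → PIso V E),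
    ν Set.univ = 1 ∧ (∀ ω : Ω, IsFinApproxSeq G (a ω)) ∧
    ∀ F : Finset E,
      Filter.Tendsto (fun n => ∫⁻ ω, pisoUACyl (a ω n) F ∂ν) Filter.atTop
        (nhds (μ {A : E → Bool | ∀ e ∈ F, A e = true}))

/-! ### Stacks -/

open Classical in
/-- The state (current vertex, remaining stacks) after `n` steps of following the stacks `σ`
starting from `o`: at each step we cross the edge at the front of the list at the current vertex
and delete it from the list (doing nothing if the list is empty). -/
noncomputable def stackState {V E : Type} (G : DigraphStruct V E) (o : V) (σ : V → List E) :
    ℕ → V × (V → List E)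
  | 0 => (o, σ)
  | n + 1 =>
    let p := stackState G o σ n
    match p.2 p.1 with
    | [] => p
    | e :: rest => (G.dst e, Function.update p.2 p.1 rest)

/-- The edge crossed at step `n` when following the stacks `σ` from `o` (`none` if the
current stack is exhausted). -/
noncomputable def stackEdge {V E : Type} (G : DigraphStruct V E) (o : V) (σ : V → List E)
    (n : ℕ) : Option E :=
  ((stackState G o σ n).2 (stackState G o σ n).1).head?

/-- The sigma-algebra on stack configurations. -/
noncomputable def stackMS (V E : Type) : MeasurableSpace (V → List E) :=
  @MeasurableSpace.pi V (fun _ => List E) fun _ => ⊤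

open Classical in
/-- `ρ` is the law of the random stack configuration built from a random arboretum with law `κ`:
place the arboretum edge at the bottom of the stack at each vertex, and an independent,
uniformly random ordering of the remaining outgoing edges on top of it. -/
def IsStackLaw {V E : Type} (G : DigraphStruct V E) (κ : Measure (E → Bool))
    (ρ : @Measure (V → List E) (stackMS V E)) : Prop :=
  ρ Set.univ = 1 ∧
    ∀ (K : Finset V) (s : V → List E),
      ρ {σ | ∀ v ∈ K, σ v = s v} =
        if ∀ v ∈ K, (s v).Nodup ∧ ∀ e : E, e ∈ s v ↔ G.src e = v then
          κ {A | ∀ v ∈ K, ∃ e : E, (s v).getLast? = some e ∧ A e = true} *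
            ∏ v ∈ K, (((G.outDeg v - 1).factorial : ℝ≥0∞))⁻¹
        else 0

/-! ### Markov chains -/

open Classical in
/-- `ν` is the law of the trajectory of a Markov chain with state space `S' ⊆ S`, transition
kernel `p` and deterministic initial state `s0`. -/
def IsMCLaw {S : Type} [MeasurableSpace S] (S' : Set S) (p : S → S → ℝ≥0∞) (s0 : S)
    (ν : Measure (ℕ → S)) : Prop :=
  ν Set.univ = 1 ∧ s0 ∈ S' ∧
  (∀ u ∈ S', (∑' v : S, p u v) = 1 ∧ ∀ v : S, p u v ≠ 0 → v ∈ S') ∧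
  (∀ u : S, u ∉ S' → ∀ v : S, p u v = 0) ∧
  ∀ (n : ℕ) (y : ℕ → S),
    ν {x | ∀ i ≤ n, x i = y i} =
      if y 0 = s0 then ∏ i ∈ Finset.range n, p (y i) (y (i + 1)) else 0

/-- `ν` is the law of the trajectory of a recurrent Markov chain on a subset of `S` with
non-random initial state: the chain returns to its initial state infinitely often a.s. -/
def IsRecMCLaw {S : Type} [MeasurableSpace S] (ν : Measure (ℕ → S)) : Prop :=
  ∃ (S' : Set S) (p : S → S → ℝ≥0∞) (s0 : S),
    IsMCLaw S' p s0 ν ∧ ν {x | {i : ℕ | x i = s0}.Infinite} = 1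

/-- `ν` is the law of the sequence of vertices visited by (the unique) proper Gibbs measure on
Eulerian paths from `o` to `∞` on a sourced Eulerian digraph whose vertex set is a subset
of `S`. -/
def IsGibbsVertexLaw {S : Type} [MeasurableSpace S] (ν : Measure (ℕ → S)) : Prop :=
  ∃ (Vs : Set S) (E : Type) (mE : MeasurableSpace E) (G : DigraphStruct (↥Vs) E) (o : ↥Vs),
    Countable E ∧ G.IsSourcedEulerian o ∧
    ∃ μp : @Measure (ℕ → E) (@MeasurableSpace.pi ℕ (fun _ => E) fun _ => mE),
      @ProperGibbs (↥Vs) E mE G o μp ∧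
      ∀ A : Set (ℕ → S), MeasurableSet A →
        ν A = μp ((fun (γ : ℕ → E) (i : ℕ) => ((G.src (γ i) : S))) ⁻¹' A)

/-- Concatenation of a finite list with an infinite sequence. -/
def concatSeq {S : Type} (l : List S) (y : ℕ → S) : ℕ → S :=
  fun i => if h : i < l.length then l.get ⟨i, h⟩ else y (i - l.length)

/-- `ν` is the law of a process following a uniform random Eulerian path on a finite Eulerian
digraph with source and sink whose vertex set is a subset of `S`, followed by the trajectory of
an (independent) recurrent Markov chain on a disjoint subset of `S` with non-random initial
state. -/
def IsMixedLaw {S : Type} [MeasurableSpace S] (ν : Measure (ℕ → S)) : Prop :=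
  ∃ (Vf : Finset S) (Ef : Type) (_ : Finite Ef)
    (Gf : DigraphStruct {s : S // s ∈ Vf} Ef) (of zf : {s : S // s ∈ Vf})
    (Vr : Set S) (p : S → S → ℝ≥0∞) (s1 : S) (νMC : Measure (ℕ → S)),
    IsFinEulerian Gf of zf ∧ Disjoint (↑Vf : Set S) Vr ∧
    IsMCLaw Vr p s1 νMC ∧ νMC {x | {i : ℕ | x i = s1}.Infinite} = 1 ∧
    ∀ A : Set (ℕ → S), MeasurableSet A →
      ν A =
        (∑' L : {L : List Ef // IsEulerList Gf of zf L},
            νMC ((fun y => concatSeq (((of : S)) ::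
              (L : List Ef).map fun e => ((Gf.dst e : S))) y) ⁻¹' A)) /
          (Nat.card {L : List Ef // IsEulerList Gf of zf L} : ℝ≥0∞)



open Classical in
/-- The sub-list of edges of `l` with tail `v`. -/
noncomputable def filt {V E : Type} (G : DigraphStruct V E) (v : V) (l : List E) : List E :=
  l.filter (fun e => decide (G.src e = v))

section lists

variable {V E : Type} {G : DigraphStruct V E}

theorem mem_filt {v : V} {l : List E} {e : E} : e ∈ filt G v l ↔ e ∈ l ∧ G.src e = v := by
  simp [filt]

theorem filt_nil (v : V) : filt G v [] = [] := by simp [filt]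

theorem filt_append (v : V) (l l' : List E) : filt G v (l ++ l') = filt G v l ++ filt G v l' := by
  simp [filt]

theorem filt_cons_self (e : E) (l : List E) : filt G (G.src e) (e :: l) = e :: filt G (G.src e) l := by
  simp [filt]

theorem filt_cons_ne {v : V} {e : E} (h : G.src e ≠ v) (l : List E) :
    filt G v (e :: l) = filt G v l := by
  simp [filt, h]

theorem pathList_unique {o z z' : V} {l : List E} (h : IsPathList G o z l)
    (h' : IsPathList G o z' l) : z = z' := by
  induction l generalizing o with
  | nil => exact h.symm.trans h'
  | cons e l ih => exact ih h.2 h'.2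

theorem pathList_append {o z : V} {l l' : List E} :
    IsPathList G o z (l ++ l') ↔ ∃ y, IsPathList G o y l ∧ IsPathList G y z l' := by
  induction l generalizing o with
  | nil => simp [IsPathList]
  | cons e l ih =>
    simp only [List.cons_append, IsPathList, ih]
    constructor
    · rintro ⟨h, y, h1, h2⟩; exact ⟨y, ⟨h, h1⟩, h2⟩
    · rintro ⟨y, ⟨h, h1⟩, h2⟩; exact ⟨h, y, h1, h2⟩

/-- A path is determined by its length and the stacks. -/
theorem path_eq_of_prefix {o z z' : V} {l l' : List E} (σ : V → List E)
    (h : IsPathList G o z l) (h' : IsPathList G o z' l') (hlen : l.length = l'.length)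
    (hp : ∀ v, filt G v l <+: σ v) (hp' : ∀ v, filt G v l' <+: σ v) : l = l' := by
  classical
  induction l generalizing o l' σ with
  | nil => simp at hlen; exact (List.length_eq_zero_iff.1 hlen.symm).symm
  | cons e l ih =>
    cases l' with
    | nil => simp at hlen
    | cons e' l' =>
      obtain ⟨h1, h2⟩ := h
      obtain ⟨h1', h2'⟩ := h'
      have hee : e = e' := by
        have a := hp o
        have a' := hp' o
        subst h1
        rw [filt_cons_self] at a
        rw [← h1', filt_cons_self, h1'] at a'
        obtain ⟨t, ht⟩ := a
        obtain ⟨t', ht'⟩ := a'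
        rw [← ht'] at ht
        simp at ht
        exact ht.1
      subst hee
      congr 1
      refine ih (fun v => if G.src e = v then (σ v).tail else σ v) h2 h2' (by simpa using hlen) ?_ ?_
      · intro v
        have := hp v
        split_ifs with hv
        · subst hv
          rw [filt_cons_self] at this
          obtain ⟨t, ht⟩ := this; exact ⟨t, by rw [← ht]; rfl⟩
        · rwa [filt_cons_ne hv] at this
      · intro v
        have := hp' v
        split_ifs with hv
        · subst hv
          rw [filt_cons_self] at this
          obtain ⟨t, ht⟩ := this; exact ⟨t, by rw [← ht]; rfl⟩
        · rwa [filt_cons_ne hv] at this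

open Classical in
theorem path_balance {o y : V} {l : List E} (h : IsPathList G o y l) (v : V) :
    l.countP (fun e => decide (G.dst e = v)) + (if o = v then 1 else 0)
      = (filt G v l).length + (if y = v then 1 else 0) := by
  induction l generalizing o with
  | nil => simp [IsPathList] at h; subst h; simp [filt]
  | cons e l ih =>
    obtain ⟨h1, h2⟩ := h
    have := ih h2
    rw [List.countP_cons]
    by_cases hv : G.src e = v
    · subst hv
      rw [filt_cons_self]
      simp only [decide_eq_true_eq, List.length_cons]
      rw [if_pos h1.symm]
      omega
    · rw [filt_cons_ne hv]
      subst h1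
      simp only [decide_eq_true_eq]
      rw [if_neg hv]
      omega

theorem nodup_of_filt {l : List E} (h : ∀ v, (filt G v l).Nodup) : l.Nodup := by
  classical
  rw [List.nodup_iff_count_le_one]
  intro e
  have := List.nodup_iff_count_le_one.1 (h (G.src e)) e
  rwa [filt, List.count_filter (by simp)] at this

theorem mem_of_perm_filt {l : List E} {τ : V → List E} (hperm : ∀ v, (τ v).Perm (filt G v l))
    {v : V} {e : E} (h : e ∈ τ v) : e ∈ l ∧ G.src e = v :=
  mem_filt.1 ((hperm v).mem_iff.1 h)

/-- The core of the BEST theorem. -/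
theorem best_core {o z : V} {l : List E} (hl : IsPathList G o z l) (hnd : l.Nodup)
    (U : Set V) (τ : V → List E)
    (hout : ∀ v, v ∉ U → τ v = filt G v l)
    (hperm : ∀ v, (τ v).Perm (filt G v l))
    (hlast : ∀ v, v ∉ U → v ≠ z → ∀ e, (filt G v l).getLast? = some e → G.dst e ∉ U)
    (hreach : ∀ v ∈ U, ∃ v', v' ∉ U ∧
      Relation.ReflTransGen (G.step {e | (τ (G.src e)).getLast? = some e}) v v') :
    ∃ l', IsPathList G o z l' ∧ l'.Perm l ∧ ∀ v, filt G v l' = τ v := by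
  classical
  -- the set of candidate lengths
  let P : ℕ → Prop := fun k => ∃ p y, IsPathList G o y p ∧ (∀ v, filt G v p <+: τ v) ∧ p.length = k
  have hτnd : ∀ v, (τ v).Nodup := fun v => (hperm v).nodup_iff.2 (hnd.filter _)
  have hpnd : ∀ p : List E, (∀ v, filt G v p <+: τ v) → p.Nodup := fun p hp =>
    nodup_of_filt (G := G) fun v => (hτnd v).sublist (hp v).sublist
  have hpsub : ∀ p : List E, (∀ v, filt G v p <+: τ v) → p ⊆ l := fun p hp e he =>
    (mem_of_perm_filt hperm ((hp (G.src e)).subset (mem_filt.2 ⟨he, rfl⟩))).1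
  have hbound : ∀ p : List E, (∀ v, filt G v p <+: τ v) → p.length ≤ l.length := fun p hp =>
    ((hpnd p hp).subperm (hpsub p hp)).length_le
  have hP0 : P 0 := ⟨[], o, rfl, fun v => by rw [filt_nil]; exact List.nil_prefix, rfl⟩
  have hPb : ∀ k, P k → k ≤ l.length := by
    rintro k ⟨p, y, _, hp, rfl⟩; exact hbound p hp
  obtain ⟨p, y, hpp, hp, hpk⟩ := Nat.findGreatest_spec (P := P) (Nat.zero_le l.length) hP0
  have hmax : ∀ k, P k → k ≤ p.length := fun k hk => by
    rw [hpk]; exact Nat.le_findGreatest (hPb k hk) hk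
  have hlen : ∀ v, (τ v).length = (filt G v l).length := fun v => (hperm v).length_eq
  have hsp : List.Subperm p l := (hpnd p hp).subperm (hpsub p hp)
  -- maximality
  have hy : filt G y p = τ y := by
    obtain ⟨t, ht⟩ := hp y
    cases t with
    | nil => simpa using ht
    | cons e t =>
      exfalso
      have hey : e ∈ τ y := by rw [← ht]; simp
      have hse : G.src e = y := (mem_of_perm_filt hperm hey).2
      have := hmax (p.length + 1) ⟨p ++ [e], G.dst e, pathList_append.2 ⟨y, hpp, hse, rfl⟩, ?_, by simp⟩
      · omega
      · intro v
        rw [filt_append]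
        by_cases hv : G.src e = v
        · have hvy : v = y := by rw [← hv, hse]
          rw [hvy]
          have : filt G y [e] = [e] := by simp [filt, hse]
          rw [this]
          exact ⟨t, by simpa using ht⟩
        · rw [filt_cons_ne hv, filt_nil, List.append_nil]; exact hp v
  have hin : ∀ v, p.countP (fun e => decide (G.dst e = v)) ≤ l.countP (fun e => decide (G.dst e = v)) :=
    fun v => hsp.countP_le _
  have hyz : z = y := by
    by_contra hne
    have b1 := path_balance hpp y
    have b2 := path_balance hl y
    have := hin y
    rw [hy, hlen] at b1
    simp [hne] at b1 b2
    omega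
  subst hyz
  -- bad vertices
  have hbad : ∀ v, filt G v p ≠ τ v →
      ∀ e, (τ v).getLast? = some e → filt G (G.dst e) p ≠ τ (G.dst e) := by
    intro v hv e he heq
    obtain ⟨t, ht⟩ := hp v
    have hne : t ≠ [] := by rintro rfl; exact hv (by simpa using ht)
    have het : e ∈ t := by
      rw [← ht, List.getLast?_append_of_ne_nil _ hne] at he
      exact List.mem_of_getLast? he
    have hsrc : G.src e = v := (mem_of_perm_filt hperm (List.mem_of_getLast? he)).2
    have hel : e ∈ l := (mem_of_perm_filt hperm (List.mem_of_getLast? he)).1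
    have hep : e ∉ p := by
      intro hep
      have hnd' := hτnd v
      rw [← ht, List.nodup_append] at hnd'
      exact hnd'.2.2 e (mem_filt.2 ⟨hep, hsrc⟩) e het rfl
    have hsp' : List.Subperm (e :: p) l := by
      refine List.Nodup.subperm (List.nodup_cons.2 ⟨hep, hpnd p hp⟩) ?_
      intro x hx
      rcases List.mem_cons.1 hx with rfl | hx
      · exact hel
      · exact hpsub p hp hx
    have := hsp'.countP_le (fun e' => decide (G.dst e' = G.dst e))
    rw [List.countP_cons] at this
    have b1 := path_balance hpp (G.dst e)
    have b2 := path_balance hl (G.dst e)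
    rw [heq, hlen] at b1
    simp only [decide_true, if_true] at this
    omega
  have hbadout : ∀ b a : List E, l = a ++ b → ∀ v, v ∉ U → filt G v p ≠ τ v → filt G v b = [] := by
    intro b
    induction b with
    | nil => intro a _ v _ _; exact filt_nil v
    | cons e b ih =>
      intro a hab v hvU hv
      have h1 := ih (a ++ [e]) (by simp [hab])
      by_cases hse : G.src e = v
      · exfalso
        have hfb := h1 v hvU hv
        have hle : (filt G v l).getLast? = some e := by
          rw [hab, filt_append]
          have : filt G v (e :: b) = [e] := by
            subst hse; rw [filt_cons_self, hfb]
          rw [this]; simp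
        have hvz : v ≠ z := by rintro rfl; exact hv hy
        have hdU := hlast v hvU hvz e hle
        have hdb := hbad v hv e (by rw [hout v hvU]; exact hle)
        have hfd := h1 _ hdU hdb
        rw [hab, pathList_append] at hl
        obtain ⟨x, _, _, hx⟩ := hl
        cases b with
        | nil =>
          have : G.dst e = z := hx
          rw [this] at hdb; exact hdb hy
        | cons e' b =>
          have : G.src e' = G.dst e := hx.1
          rw [← this, filt_cons_self] at hfd
          simp at hfd
      · rw [filt_cons_ne hse]; exact h1 v hvU hv
  have hgoodout : ∀ v, v ∉ U → filt G v p = τ v := by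
    intro v hvU
    by_contra hv
    have h1 := hbadout l [] rfl v hvU hv
    rw [← hout v hvU] at h1
    have := hp v
    rw [h1] at this hv
    exact hv (by simpa using this)
  have hgood : ∀ v, filt G v p = τ v := by
    intro v
    by_cases hvU : v ∈ U
    · by_contra hv
      obtain ⟨v', hv', hr⟩ := hreach v hvU
      have : filt G v' p ≠ τ v' := by
        clear hv'
        induction hr with
        | refl => exact hv
        | tail _ hs ih =>
          obtain ⟨e, he, rfl, rfl⟩ := hs
          exact hbad _ ih e he
      exact this (hgoodout v' hv')
    · exact hgoodout v hvU
  refine ⟨p, hpp, ?_, hgood⟩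
  rw [List.perm_ext_iff_of_nodup (hpnd p hp) hnd]
  intro e
  refine ⟨fun h => hpsub p hp h, fun h => ?_⟩
  have : e ∈ filt G (G.src e) p := by
    rw [hgood, (hperm _).mem_iff]; exact mem_filt.2 ⟨h, rfl⟩
  exact (mem_filt.1 this).1

end lists


section inf

variable {V E : Type} {G : DigraphStruct V E}

/-- Half-infinite Eulerian paths from `o`. -/
structure Eul (G : DigraphStruct V E) (o : V) (γ : ℕ → E) : Prop where
  path : ∀ i : ℕ, G.dst (γ i) = G.src (γ (i + 1))
  start : G.src (γ 0) = o
  bij : Function.Bijective γ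

/-- The first `n` steps. -/
def pre (γ : ℕ → E) (n : ℕ) : List E := (List.range n).map γ

theorem pre_succ (γ : ℕ → E) (n : ℕ) : pre γ (n + 1) = pre γ n ++ [γ n] := by
  simp [pre, List.range_succ]

theorem pre_length (γ : ℕ → E) (n : ℕ) : (pre γ n).length = n := by simp [pre]

theorem mem_pre {γ : ℕ → E} {n : ℕ} {e : E} : e ∈ pre γ n ↔ ∃ i < n, γ i = e := by
  simp [pre]

theorem Eul.pre_path {o : V} {γ : ℕ → E} (h : Eul G o γ) (n : ℕ) :
    IsPathList G o (G.src (γ n)) (pre γ n) := by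
  induction n with
  | zero => exact h.start.symm
  | succ n ih =>
    rw [pre_succ, pathList_append]
    exact ⟨_, ih, rfl, h.path n⟩

theorem pre_nodup {γ : ℕ → E} (h : Function.Injective γ) (n : ℕ) : (pre γ n).Nodup :=
  List.nodup_range.map h

theorem filt_pre_const {γ : ℕ → E} {v : V} {n : ℕ} (h : ∀ t, n ≤ t → G.src (γ t) ≠ v) :
    ∀ m, n ≤ m → filt G v (pre γ m) = filt G v (pre γ n) := by
  intro m hm
  induction m, hm using Nat.le_induction with
  | base => rfl
  | succ m hm ih =>
    rw [pre_succ, filt_append, ih, filt_cons_ne (h m hm), filt_nil, List.append_nil]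

theorem Eul.visits {o : V} {γ : ℕ → E} (h : Eul G o γ) (hf : G.LocallyFinite) (v : V) :
    ∃ n, ∀ t, n ≤ t → G.src (γ t) ≠ v := by
  have : (γ ⁻¹' (G.outEdges v)).Finite := (hf v).1.preimage h.bij.1.injOn
  obtain ⟨n, hn⟩ := this.bddAbove
  refine ⟨n + 1, fun t ht hv => ?_⟩
  have := hn (show t ∈ γ ⁻¹' (G.outEdges v) from hv)
  omega

open Classical in
/-- The stack at `v` associated with an infinite path. -/
noncomputable def stk (G : DigraphStruct V E) (γ : ℕ → E) (v : V) : List E :=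
  if h : ∃ l, ∃ N, ∀ m, N ≤ m → filt G v (pre γ m) = l then h.choose else []

theorem stk_eq {γ : ℕ → E} {v : V} {l : List E} (h : ∃ N, ∀ m, N ≤ m → filt G v (pre γ m) = l) :
    stk G γ v = l := by
  have h' : ∃ l, ∃ N, ∀ m, N ≤ m → filt G v (pre γ m) = l := ⟨l, h⟩
  rw [stk, dif_pos h']
  obtain ⟨N, hN⟩ := h'.choose_spec
  obtain ⟨M, hM⟩ := h
  rw [← hN (max N M) (le_max_left _ _), hM (max N M) (le_max_right _ _)]

theorem stk_eq_filt {γ : ℕ → E} {v : V} {n : ℕ} (h : ∀ t, n ≤ t → G.src (γ t) ≠ v) :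
    stk G γ v = filt G v (pre γ n) := stk_eq ⟨n, filt_pre_const h⟩

theorem filt_pre_prefix {γ : ℕ → E} {v : V} {n m : ℕ} (h : n ≤ m) :
    filt G v (pre γ n) <+: filt G v (pre γ m) := by
  induction m, h using Nat.le_induction with
  | base => exact List.prefix_rfl
  | succ m hm ih =>
    rw [pre_succ, filt_append]
    exact ih.trans (List.prefix_append _ _)

theorem Eul.filt_prefix_stk {o : V} {γ : ℕ → E} (h : Eul G o γ) (hf : G.LocallyFinite) (v : V)
    (n : ℕ) : filt G v (pre γ n) <+: stk G γ v := by
  obtain ⟨N, hN⟩ := h.visits hf v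
  rw [stk_eq_filt hN, ← filt_pre_const hN (max n N) (le_max_right _ _)]
  exact filt_pre_prefix (le_max_left _ _)

/-- A valid stack at `v`. -/
def ValidAt (G : DigraphStruct V E) (v : V) (l : List E) : Prop :=
  l.Nodup ∧ ∀ e : E, e ∈ l ↔ G.src e = v

theorem Eul.stk_valid {o : V} {γ : ℕ → E} (h : Eul G o γ) (hf : G.LocallyFinite) (v : V) :
    ValidAt G v (stk G γ v) := by
  obtain ⟨N, hN⟩ := h.visits hf v
  constructor
  · rw [stk_eq_filt hN]; exact (pre_nodup h.bij.1 N).filter _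
  · intro e
    rw [stk_eq_filt hN, mem_filt]
    refine ⟨fun x => x.2, fun x => ⟨?_, x⟩⟩
    obtain ⟨i, rfl⟩ := h.bij.2 e
    rw [mem_pre]
    refine ⟨i, ?_, rfl⟩
    by_contra hi
    exact hN i (by omega) x

theorem Eul.exists_visit {o : V} {γ : ℕ → E} (h : Eul G o γ) (hG : G.IsSourcedEulerian o) (v : V) :
    ∃ i, G.src (γ i) = v := by
  have := hG.infinite
  obtain ⟨u, hu⟩ := exists_ne v
  have hc := hG.conn v u
  rcases hc.cases_head with rfl | ⟨c, ⟨e, he⟩, _⟩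
  · exact absurd rfl hu
  · obtain ⟨i, rfl⟩ := h.bij.2 e
    rcases he with ⟨h1, _⟩ | ⟨_, h2⟩
    · exact ⟨i, h1⟩
    · exact ⟨i + 1, by rw [← h.path, h2]⟩

/-- The last-exit edges. -/
def LE (G : DigraphStruct V E) (γ : ℕ → E) : Set E :=
  {e | (stk G γ (G.src e)).getLast? = some e}

theorem Eul.exists_time {o : V} {γ : ℕ → E} (h : Eul G o γ) (hG : G.IsSourcedEulerian o) :
    ∃ T : V → ℕ, ∀ v, G.src (γ (T v)) = v ∧ (∀ j, T v < j → G.src (γ j) ≠ v) ∧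
      (stk G γ v).getLast? = some (γ (T v)) := by
  classical
  have key : ∀ v, ∃ t, G.src (γ t) = v ∧ (∀ j, t < j → G.src (γ j) ≠ v) := by
    intro v
    obtain ⟨i, hi⟩ := h.exists_visit hG v
    obtain ⟨N, hN⟩ := h.visits hG.locFin v
    have hiN : i ≤ N := by
      by_contra hc
      exact hN i (by omega) hi
    refine ⟨Nat.findGreatest (fun t => G.src (γ t) = v) N,
      Nat.findGreatest_spec (P := fun t => G.src (γ t) = v) hiN hi, fun j hj hjv => ?_⟩
    have hjN : j ≤ N := by
      by_contra hc
      exact hN j (by omega) hjv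
    exact absurd (Nat.le_findGreatest (P := fun t => G.src (γ t) = v) hjN hjv) (by omega)
  choose T hT1 hT2 using key
  refine ⟨T, fun v => ⟨hT1 v, hT2 v, ?_⟩⟩
  rw [stk_eq_filt (n := T v + 1) (fun t ht => hT2 v t (by omega)), pre_succ, filt_append]
  have : filt G v [γ (T v)] = [γ (T v)] := by simp [filt, hT1 v]
  rw [this]; simp

theorem mem_LE_iff {γ : ℕ → E} {T : V → ℕ}
    (hT : ∀ v, G.src (γ (T v)) = v ∧ (∀ j, T v < j → G.src (γ j) ≠ v) ∧
      (stk G γ v).getLast? = some (γ (T v))) {e : E} :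
    e ∈ LE G γ ↔ e = γ (T (G.src e)) := by
  rw [LE, mem_ofPred_eq, (hT (G.src e)).2.2, Option.some_inj, eq_comm]

theorem time_lt {o : V} {γ : ℕ → E} (h : Eul G o γ) {T : V → ℕ}
    (hT : ∀ v, G.src (γ (T v)) = v ∧ (∀ j, T v < j → G.src (γ j) ≠ v) ∧
      (stk G γ v).getLast? = some (γ (T v))) {u v : V} (hs : G.step (LE G γ) u v) : T u < T v := by
  obtain ⟨e, he, rfl, rfl⟩ := hs
  rw [mem_LE_iff hT] at he
  by_contra hc
  refine (hT (G.dst e)).2.1 (T (G.src e) + 1) (by omega) ?_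
  rw [← h.path, ← he]

theorem Eul.past_finite {o : V} {γ : ℕ → E} (h : Eul G o γ) (hG : G.IsSourcedEulerian o) (v : V) :
    {u | Relation.ReflTransGen (G.step (LE G γ)) u v}.Finite := by
  obtain ⟨T, hT⟩ := h.exists_time hG
  have hinj : Function.Injective T := fun a b hab => by
    rw [← (hT a).1, ← (hT b).1, hab]
  refine ((Set.finite_Iic (T v)).preimage hinj.injOn).subset ?_
  intro u hu
  simp only [mem_preimage, mem_Iic]
  induction hu with
  | refl => exact le_rfl
  | tail _ hs ih => exact ih.trans (time_lt h hT hs).le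

/-- The bottom edges of a stack configuration over `U`. -/
def bot (G : DigraphStruct V E) (U : Set V) (s : V → List E) : Set E :=
  {e | G.src e ∈ U ∧ (s (G.src e)).getLast? = some e}

theorem Eul.bot_arb {o : V} {γ : ℕ → E} (h : Eul G o γ) (hG : G.IsSourcedEulerian o) {U : Set V}
    (hU : U.Finite) : IsWiredArb G U (bot G U (stk G γ)) := by
  obtain ⟨T, hT⟩ := h.exists_time hG
  refine ⟨fun e he => he.1, fun v hv => ⟨γ (T v), ⟨⟨?_, ?_⟩, (hT v).1⟩, ?_⟩, ?_⟩
  · rw [(hT v).1]; exact hv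
  · rw [(hT v).1]; exact (hT v).2.2
  · rintro e ⟨⟨_, h2⟩, rfl⟩
    exact (mem_LE_iff hT).1 h2
  · obtain ⟨M, hM⟩ := (hU.image T).bddAbove
    have : ∀ k v, v ∈ U → M - T v ≤ k →
        ∃ v', v' ∉ U ∧ Relation.ReflTransGen (G.step (bot G U (stk G γ))) v v' := by
      intro k
      induction k with
      | zero =>
        intro v hv hk
        have hs : G.step (bot G U (stk G γ)) v (G.dst (γ (T v))) :=
          ⟨_, ⟨by rw [(hT v).1]; exact hv, by rw [(hT v).1]; exact (hT v).2.2⟩, (hT v).1, rfl⟩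
        refine ⟨_, fun hd => ?_, Relation.ReflTransGen.single hs⟩
        have h1 := hM (mem_image_of_mem T hd)
        have h2 : T v < T (G.dst (γ (T v))) := time_lt h hT (by
          obtain ⟨e, he, h3⟩ := hs; exact ⟨e, he.2, h3⟩)
        omega
      | succ k ih =>
        intro v hv hk
        have hs : G.step (bot G U (stk G γ)) v (G.dst (γ (T v))) :=
          ⟨_, ⟨by rw [(hT v).1]; exact hv, by rw [(hT v).1]; exact (hT v).2.2⟩, (hT v).1, rfl⟩
        have h2 : T v < T (G.dst (γ (T v))) := time_lt h hT (by
          obtain ⟨e, he, h3⟩ := hs; exact ⟨e, he.2, h3⟩)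
        by_cases hd : G.dst (γ (T v)) ∈ U
        · obtain ⟨v', hv', hr⟩ := ih _ hd (by omega)
          exact ⟨v', hv', Relation.ReflTransGen.head hs hr⟩
        · exact ⟨_, hd, Relation.ReflTransGen.single hs⟩
    exact fun v hv => this _ v hv le_rfl

/-- After time `n`, the path visits neither `U` nor its in-neighbours. -/
def Done (G : DigraphStruct V E) (U : Set V) (γ : ℕ → E) (n : ℕ) : Prop :=
  ∀ t, n ≤ t → G.src (γ t) ∉ U ∧ ∀ e, G.dst e ∈ U → G.src e ≠ G.src (γ t)

theorem Eul.exists_done {o : V} {γ : ℕ → E} (h : Eul G o γ) (hf : G.LocallyFinite) {U : Set V}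
    (hU : U.Finite) : ∃ n, Done G U γ n := by
  have hfin : (U ∪ G.src '' (⋃ v ∈ U, G.inEdges v)).Finite :=
    hU.union ((hU.biUnion fun v _ => (hf v).2).image _)
  choose N hN using fun v => h.visits hf v
  obtain ⟨M, hM⟩ := (hfin.image N).bddAbove
  refine ⟨M, fun t ht => ⟨fun htU => ?_, fun e he heq => ?_⟩⟩
  · exact hN (G.src (γ t)) t ((hM (mem_image_of_mem N (Or.inl htU))).trans ht) rfl
  · have : G.src (γ t) ∈ U ∪ G.src '' (⋃ v ∈ U, G.inEdges v) := by
      rw [← heq]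
      refine Or.inr (mem_image_of_mem _ ?_)
      simp only [mem_iUnion]
      exact ⟨G.dst e, he, rfl⟩
    exact hN (G.src (γ t)) t ((hM (mem_image_of_mem N this)).trans ht) rfl

theorem Done.mono {U : Set V} {γ : ℕ → E} {n m : ℕ} (h : Done G U γ n) (hnm : n ≤ m) :
    Done G U γ m := fun t ht => h t (hnm.trans ht)

/-- Rearranging the stacks over a set closed under the past. -/
theorem Eul.exists_swap {o : V} {γ : ℕ → E} (h : Eul G o γ) (hf : G.LocallyFinite) {U : Set V}
    {n : ℕ} (hn : Done G U γ n) (hpast : ∀ e ∈ LE G γ, G.dst e ∈ U → G.src e ∈ U)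
    {s : V → List E} (hs : ∀ v ∈ U, ValidAt G v (s v)) (harb : IsWiredArb G U (bot G U s)) :
    ∃ l', IsPathList G o (G.src (γ n)) l' ∧ l'.Perm (pre γ n) ∧
      (∀ v, v ∉ U → filt G v l' = filt G v (pre γ n)) ∧ ∀ v ∈ U, filt G v l' = s v := by
  classical
  have hstkU : ∀ v ∈ U, stk G γ v = filt G v (pre γ n) := fun v hv =>
    stk_eq_filt fun t ht hc => (hn t ht).1 (by rw [hc]; exact hv)
  refine Exists.elim (best_core (h.pre_path n) (pre_nodup h.bij.1 n) U
    (fun v => if v ∈ U then s v else filt G v (pre γ n))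
    (fun v hv => by simp [hv]) ?_ ?_ ?_) ?_
  · intro v
    by_cases hv : v ∈ U
    · simp only [hv, if_true]
      rw [← hstkU v hv, List.perm_ext_iff_of_nodup (hs v hv).1 (h.stk_valid hf v).1]
      intro e
      rw [(hs v hv).2, (h.stk_valid hf v).2]
    · simp [hv]
  · intro v hv _ e he hd
    have hev : G.src e = v := (mem_filt.1 (List.mem_of_getLast? he)).2
    have : stk G γ v = filt G v (pre γ n) := stk_eq_filt fun t ht hc =>
      (hn t ht).2 e hd (by rw [hev, hc])
    rw [← this, ← hev] at he
    exact hv (by rw [← hev]; exact hpast e he hd)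
  · intro v hv
    obtain ⟨v', hv', hr⟩ := harb.2.2 v hv
    refine ⟨v', hv', Relation.ReflTransGen.mono ?_ _ _ hr⟩
    rintro a b ⟨e, he, h1, h2⟩
    refine ⟨e, ?_, h1, h2⟩
    simp only [mem_ofPred_eq, he.1, if_true]
    exact he.2
  · rintro l' ⟨h1, h2, h3⟩
    exact ⟨l', h1, h2, fun v hv => by rw [h3]; simp [hv], fun v hv => by rw [h3]; simp [hv]⟩

/-- Replace the first steps of a path. -/
def splice (l : List E) (γ : ℕ → E) : ℕ → E := fun i => if h : i < l.length then l[i] else γ i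

theorem splice_ge {l : List E} {γ : ℕ → E} {i : ℕ} (h : l.length ≤ i) : splice l γ i = γ i := by
  simp [splice, not_lt.2 h]

theorem splice_lt {l : List E} {γ : ℕ → E} {i : ℕ} (h : i < l.length) : splice l γ i = l[i] := by
  simp [splice, h]

theorem pre_splice (l : List E) (γ : ℕ → E) : pre (splice l γ) l.length = l := by
  apply List.ext_getElem
  · simp [pre_length]
  · intro i h1 h2
    simp [pre, splice_lt h2]

theorem pathList_succ {o z : V} {l : List E} (h : IsPathList G o z l) (i : ℕ) (hi : i + 1 < l.length) :
    G.dst l[i] = G.src l[i + 1] := by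
  induction l generalizing o i with
  | nil => simp at hi
  | cons e l ih =>
    cases i with
    | zero =>
      cases l with
      | nil => simp at hi
      | cons e' l => simpa using h.2.1.symm
    | succ i => simpa using ih h.2 i (by simpa using hi)

theorem pathList_last {o z : V} {l : List E} (h : IsPathList G o z l) (i : ℕ) (hi : i + 1 = l.length) :
    G.dst (l[i]'(by omega)) = z := by
  induction l generalizing o i with
  | nil => simp at hi
  | cons e l ih =>
    cases i with
    | zero =>
      cases l with
      | nil => exact h.2
      | cons e' l => simp at hi
    | succ i => simpa using ih h.2 i (by simpa using hi)

theorem pathList_zero {o z : V} {l : List E} (h : IsPathList G o z l) (hi : 0 < l.length) :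
    G.src l[0] = o := by
  cases l with
  | nil => simp at hi
  | cons e l => exact h.1

theorem Eul.splice_eul {o : V} {γ : ℕ → E} (h : Eul G o γ) {n : ℕ} {l : List E}
    (hl : IsPathList G o (G.src (γ n)) l) (hp : l.Perm (pre γ n)) : Eul G o (splice l γ) := by
  have hlen : l.length = n := by rw [hp.length_eq, pre_length]
  have hmem : ∀ e, e ∈ l ↔ ∃ i < n, γ i = e := fun e => by rw [hp.mem_iff, mem_pre]
  refine ⟨fun i => ?_, ?_, ?_, ?_⟩
  · rcases lt_trichotomy (i + 1) n with hi | hi | hi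
    · rw [splice_lt (by omega), splice_lt (by omega)]
      exact pathList_succ hl i (by omega)
    · rw [splice_lt (by omega), splice_ge (by omega), pathList_last hl i (by omega), hi]
    · rw [splice_ge (by omega), splice_ge (by omega), h.path]
  · by_cases hn : 0 < l.length
    · rw [splice_lt hn]; exact pathList_zero hl hn
    · rw [splice_ge (by omega)]; exact h.start
  · have hnd : l.Nodup := hp.nodup_iff.2 (pre_nodup h.bij.1 n)
    have hx : ∀ i j, i < n → n ≤ j → splice l γ i ≠ splice l γ j := by
      intro i j hi hj heq
      rw [splice_lt (by omega), splice_ge (by omega)] at heq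
      obtain ⟨k, hk, hke⟩ := (hmem _).1 (List.getElem_mem (l := l) (n := i) (by omega))
      rw [heq] at hke
      have := h.bij.1 hke
      omega
    intro i j hij
    by_cases hi : i < n <;> by_cases hj : j < n
    · rw [splice_lt (by omega), splice_lt (by omega)] at hij
      exact (hnd.getElem_inj_iff).1 hij
    · exact absurd hij (hx i j hi (by omega))
    · exact absurd hij.symm (hx j i hj (by omega))
    · rw [splice_ge (by omega), splice_ge (by omega)] at hij
      exact h.bij.1 hij
  · intro e
    obtain ⟨k, rfl⟩ := h.bij.2 e
    by_cases hk : k < n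
    · obtain ⟨i, hi, hie⟩ := List.getElem_of_mem ((hmem (γ k)).2 ⟨k, hk, rfl⟩)
      exact ⟨i, by rw [splice_lt hi, hie]⟩
    · exact ⟨k, splice_ge (by omega)⟩

theorem filt_pre_splice {γ : ℕ → E} {l : List E} {v : V} {n : ℕ} (hlen : l.length = n)
    (hl : filt G v l = filt G v (pre γ n)) (m : ℕ) (hm : n ≤ m) :
    filt G v (pre (splice l γ) m) = filt G v (pre γ m) := by
  induction m, hm using Nat.le_induction with
  | base => rw [← hlen, pre_splice, hl, hlen]
  | succ m hm ih => rw [pre_succ, pre_succ, filt_append, filt_append, ih, splice_ge (by omega)]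

theorem Done.splice {U : Set V} {γ : ℕ → E} {l : List E} {n : ℕ} (hlen : l.length = n)
    (h : Done G U γ n) : Done G U (splice l γ) n := by
  intro t ht
  rw [splice_ge (by omega)]
  exact h t ht

theorem stk_splice_out {o : V} {γ : ℕ → E} (h : Eul G o γ) (hf : G.LocallyFinite) {l : List E} {v : V}
    {n : ℕ} (hlen : l.length = n)
    (hl : filt G v l = filt G v (pre γ n)) : stk G (splice l γ) v = stk G γ v := by
  obtain ⟨N, hN⟩ := h.visits hf v
  apply stk_eq
  refine ⟨max n N, fun m hm => ?_⟩
  rw [filt_pre_splice hlen hl m ((le_max_left _ _).trans hm)]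
  exact (stk_eq_filt fun t ht => hN t (((le_max_right n N).trans hm).trans ht)).symm

theorem stk_splice_in {U : Set V} {γ : ℕ → E} {l : List E} {v : V}
    {n : ℕ} (hlen : l.length = n) (hn : Done G U γ n) (hv : v ∈ U) :
    stk G (splice l γ) v = filt G v l := by
  rw [stk_eq_filt (n := n), ← hlen, pre_splice]
  intro t ht hc
  rw [splice_ge (by omega)] at hc
  exact (hn t ht).1 (by rw [hc]; exact hv)

/-- The largest subset of `W` closed under the past. -/
def UW (G : DigraphStruct V E) (A : Set E) (W : Set V) : Set V :=
  {v | v ∈ W ∧ ∀ u, Relation.ReflTransGen (G.step A) u v → u ∈ W}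

theorem UW_closed {A : Set E} {W : Set V} {e : E} (he : e ∈ A) (hd : G.dst e ∈ UW G A W) :
    G.src e ∈ UW G A W := by
  have hs : G.step A (G.src e) (G.dst e) := ⟨e, he, rfl, rfl⟩
  exact ⟨hd.2 _ (Relation.ReflTransGen.single hs), fun u hu => hd.2 u (hu.tail hs)⟩

theorem UW_congr {A A' : Set E} {W U : Set V} (hU : UW G A W = U)
    (hA : ∀ e, G.src e ∉ U → (e ∈ A ↔ e ∈ A')) : UW G A' W = U := by
  have hcl : ∀ e ∈ A', G.dst e ∈ U → G.src e ∈ U := by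
    intro e he hd
    by_contra hs
    rw [← hU] at hd hs
    exact hs (UW_closed ((hA e (by rw [← hU]; exact hs)).2 he) hd)
  apply Set.Subset.antisymm
  · intro v hv
    by_contra hvU
    have hvW := hv.1
    rw [← hU] at hvU
    have : ∃ u, Relation.ReflTransGen (G.step A) u v ∧ u ∉ W := by
      by_contra hc
      push Not at hc
      exact hvU ⟨hvW, hc⟩
    obtain ⟨u, hu, huW⟩ := this
    have key : Relation.ReflTransGen (G.step A') u v ∧ v ∉ U := by
      clear hvU hvW hv
      induction hu with
      | refl => exact ⟨.refl, fun hc => huW (by rw [← hU] at hc; exact hc.1)⟩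
      | tail _ hs ih =>
        obtain ⟨e, he, rfl, rfl⟩ := hs
        refine ⟨ih.1.tail ⟨e, (hA e ih.2).1 he, rfl, rfl⟩, fun hc => ih.2 ?_⟩
        rw [← hU] at hc ⊢
        exact UW_closed he hc
    exact huW (hv.2 u key.1)
  · intro v hv
    have hUW : U ⊆ W := by rw [← hU]; exact fun x hx => hx.1
    refine ⟨hUW hv, fun u hu => hUW ?_⟩
    induction hu with
    | refl => exact hv
    | tail _ hs ih =>
      obtain ⟨e, he, rfl, rfl⟩ := hs
      exact ih (hcl e he hv)

end inf


theorem measure_eq_tsum_fiber {α β : Type*} [MeasurableSpace α] [Countable β] (μ : Measure α)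
    (f : α → β) (hf : ∀ b, MeasurableSet (f ⁻¹' {b})) (T : Set α) :
    μ T = ∑' b, μ (f ⁻¹' {b} ∩ T) := by
  have h1 : (μ.restrict T) univ = ∑' b, (μ.restrict T) (f ⁻¹' {b}) := by
    rw [← measure_iUnion _ hf]
    · congr 1
      ext x
      simp
    · intro a b hab
      refine Set.disjoint_left.2 fun x hx hx' => hab ?_
      rw [← (show f x = a from hx), ← (show f x = b from hx')]
  rw [Measure.restrict_apply_univ] at h1
  rw [h1]
  exact tsum_congr fun b => Measure.restrict_apply (hf b)

section swap

variable {V E : Type} {G : DigraphStruct V E}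

/-- The event used in the exchange argument. -/
def TEv (G : DigraphStruct V E) (o : V) (U W : Set V) (n : ℕ) (s : V → List E) : Set (ℕ → E) :=
  {γ | Eul G o γ ∧ (∀ v ∈ U, stk G γ v = s v) ∧ UW G (LE G γ) W = U ∧ Done G U γ n}

theorem swap_mem {o : V} (hf : G.LocallyFinite) {U W : Set V} {n : ℕ} {s s' : V → List E}
    {γ : ℕ → E} (hγ : γ ∈ TEv G o U W n s) {l : List E}
    (h1 : IsPathList G o (G.src (γ n)) l) (h2 : l.Perm (pre γ n))
    (h3 : ∀ v, v ∉ U → filt G v l = filt G v (pre γ n)) (h4 : ∀ v ∈ U, filt G v l = s' v) :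
    splice l γ ∈ TEv G o U W n s' := by
  have hlen : l.length = n := by rw [h2.length_eq, pre_length]
  obtain ⟨hE, hs, hU, hD⟩ := hγ
  refine ⟨hE.splice_eul h1 h2, fun v hv => ?_, ?_, hD.splice hlen⟩
  · rw [stk_splice_in hlen hD hv, h4 v hv]
  · refine UW_congr hU fun e he => ?_
    simp only [LE, mem_ofPred_eq]
    rw [stk_splice_out hE hf hlen (h3 _ he)]

theorem fiber_meas [Countable E] [MeasurableSpace E] [DiscreteMeasurableSpace E] (n : ℕ)
    (C : Set (Fin n → E)) :
    MeasurableSet ((fun (γ : ℕ → E) (i : Fin n) => γ i) ⁻¹' C) := by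
  have hm : Measurable (fun (γ : ℕ → E) (i : Fin n) => γ i) := by fun_prop
  exact hm (MeasurableSet.of_discrete)

theorem swap_le [Countable E] [MeasurableSpace E] [DiscreteMeasurableSpace E] {o : V}
    (hf : G.LocallyFinite) {μ : Measure (ℕ → E)} (hμ : ProperGibbs G o μ) {U W : Set V} (n : ℕ)
    (s s' : V → List E) (hs' : ∀ v ∈ U, ValidAt G v (s' v)) (harb : IsWiredArb G U (bot G U s')) :
    μ (TEv G o U W n s) ≤ μ (TEv G o U W n s') := by
  classical
  let f : (ℕ → E) → (Fin n → E) := fun γ i => γ i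
  let R : Set (Fin n → E) := {w | (f ⁻¹' {w} ∩ TEv G o U W n s).Nonempty}
  have hpre : ∀ γ γ' : ℕ → E, f γ = f γ' → pre γ n = pre γ' n := by
    intro γ γ' h
    apply List.map_congr_left
    intro i hi
    exact congrFun h ⟨i, List.mem_range.1 hi⟩
  have key : ∀ w : R, ∃ l : List E, ∀ γ, f γ = w → γ ∈ TEv G o U W n s →
      IsPathList G o (G.src (γ n)) l ∧ l.Perm (pre γ n) ∧
      (∀ v, v ∉ U → filt G v l = filt G v (pre γ n)) ∧ ∀ v ∈ U, filt G v l = s' v := by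
    rintro ⟨w, γ0, h0, hT0⟩
    have h0 : f γ0 = w := h0
    obtain ⟨hE, hs, hU, hD⟩ := hT0
    obtain ⟨l, h1, h2, h3, h4⟩ := hE.exists_swap hf hD
      (fun e he hd => by rw [← hU] at hd ⊢; exact UW_closed he hd) hs' harb
    refine ⟨l, fun γ hγ hγT => ?_⟩
    have hp : pre γ n = pre γ0 n := hpre _ _ (hγ.trans h0.symm)
    have hz : G.src (γ n) = G.src (γ0 n) := by
      have a := hγT.1.pre_path n
      rw [hp] at a
      exact pathList_unique a (hE.pre_path n)
    rw [hz, hp]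
    exact ⟨h1, h2, h3, h4⟩
  choose Lw hL using key
  have hlen : ∀ w : R, (Lw w).length = n := by
    rintro ⟨w, hw⟩
    obtain ⟨γ0, h0, hT0⟩ := id hw
    rw [(hL ⟨w, hw⟩ γ0 h0 hT0).2.1.length_eq, pre_length]
  let Φ : R → (Fin n → E) := fun w i => (Lw w)[i]'(by rw [hlen w]; exact i.2)
  have hsp : ∀ (w : R) (γ : ℕ → E), f (splice (Lw w) γ) = Φ w := by
    intro w γ
    funext i
    exact splice_lt (by rw [hlen w]; exact i.2)
  have hΦinj : Function.Injective Φ := by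
    intro w1 w2 h12
    have hl12 : Lw w1 = Lw w2 := by
      apply List.ext_getElem
      · rw [hlen, hlen]
      · intro i h1 h2
        exact congrFun h12 ⟨i, by rw [← hlen w1]; exact h1⟩
    obtain ⟨w1, hw1⟩ := w1
    obtain ⟨w2, hw2⟩ := w2
    obtain ⟨γ1, a1, b1⟩ := id hw1
    obtain ⟨γ2, a2, b2⟩ := id hw2
    have c1 := hL ⟨w1, hw1⟩ γ1 a1 b1
    have c2 := hL ⟨w2, hw2⟩ γ2 a2 b2
    rw [← hl12] at c2
    have hstk : ∀ v, filt G v (pre γ1 n) = filt G v (pre γ2 n) := by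
      intro v
      by_cases hv : v ∈ U
      · have d1 : stk G γ1 v = filt G v (pre γ1 n) := stk_eq_filt fun t ht hc =>
          (b1.2.2.2 t ht).1 (by rw [hc]; exact hv)
        have d2 : stk G γ2 v = filt G v (pre γ2 n) := stk_eq_filt fun t ht hc =>
          (b2.2.2.2 t ht).1 (by rw [hc]; exact hv)
        rw [← d1, ← d2, b1.2.1 v hv, b2.2.1 v hv]
      · rw [← c1.2.2.1 v hv, ← c2.2.2.1 v hv]
    have hpp : pre γ1 n = pre γ2 n :=
      path_eq_of_prefix (fun v => filt G v (pre γ1 n)) (b1.1.pre_path n) (b2.1.pre_path n)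
        (by rw [pre_length, pre_length]) (fun v => List.prefix_rfl)
        (fun v => by rw [← hstk v])
    apply Subtype.ext
    change w1 = w2
    rw [← (show f γ1 = w1 from a1), ← (show f γ2 = w2 from a2)]
    funext i
    have e1 : (pre γ1 n)[(i : ℕ)]'(by rw [pre_length]; exact i.2) =
      (pre γ2 n)[(i : ℕ)]'(by rw [pre_length]; exact i.2) := by simp only [hpp]
    simpa [pre] using e1
  have hle : ∀ w : R, μ (f ⁻¹' {(w : Fin n → E)} ∩ TEv G o U W n s) ≤
      μ (f ⁻¹' {Φ w} ∩ TEv G o U W n s') := by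
    rintro ⟨w, hw⟩
    obtain ⟨γ0, a0, b0⟩ := id hw
    have a0 : f γ0 = w := a0
    have c0 := hL ⟨w, hw⟩ γ0 a0 b0
    have hsp0 := hsp ⟨w, hw⟩ γ0
    have hE' : Eul G o (splice (Lw ⟨w, hw⟩) γ0) := b0.1.splice_eul c0.1 c0.2.1
    let B : Set (ℕ → E) := {τ | ∃ γ ∈ TEv G o U W n s, f γ = w ∧ ∀ t, γ (n + t) = τ t}
    have hpfx : ∀ γ : ℕ → E, Eul G o γ → Function.Injective (f γ) ∧ PrefixPath G o (f γ) := by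
      intro γ hγ
      refine ⟨fun i j hij => Fin.ext (hγ.bij.1 hij), fun h => hγ.start, fun i h => hγ.path i⟩
    have hrange : ∀ γ : ℕ → E, Set.range (f γ) = {e | e ∈ pre γ n} := by
      intro γ
      ext e
      simp only [mem_range, mem_ofPred_eq, mem_pre, f]
      constructor
      · rintro ⟨i, hi⟩; exact ⟨i, i.2, hi⟩
      · rintro ⟨i, hi, he⟩; exact ⟨⟨i, hi⟩, he⟩
    have hg := hμ.2.2 n w (Φ ⟨w, hw⟩) (by rw [← a0]; exact (hpfx _ b0.1).1)
      (by rw [← hsp0]; exact (hpfx _ hE').1)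
      (by
        have hr : Set.range w = {e | e ∈ pre γ0 n} := by rw [← a0, hrange]
        rw [hr, ← hsp0, hrange]
        ext e
        have hl := hlen ⟨w, hw⟩
        have : pre (splice (Lw ⟨w, hw⟩) γ0) n = Lw ⟨w, hw⟩ := by
          have := pre_splice (Lw ⟨w, hw⟩) γ0
          rwa [hl] at this
        simp only [mem_ofPred_eq]
        rw [this, c0.2.1.mem_iff])
      (by rw [← a0]; exact (hpfx _ b0.1).2)
      (by rw [← hsp0]; exact (hpfx _ hE').2) B
    calc μ (f ⁻¹' {w} ∩ TEv G o U W n s)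
        ≤ μ {γ | (∀ i : Fin n, γ (i : ℕ) = w i) ∧ (fun t : ℕ => γ (n + t)) ∈ B} := by
          refine measure_mono ?_
          rintro γ ⟨h1, h2⟩
          exact ⟨fun i => congrFun h1 i, γ, h2, h1, fun t => rfl⟩
      _ = _ := hg
      _ ≤ _ := by
          refine measure_mono ?_
          rintro γ1 ⟨h1, γ, h2, h3, h4⟩
          have c := hL ⟨w, hw⟩ γ h3 h2
          have : γ1 = splice (Lw ⟨w, hw⟩) γ := by
            funext i
            by_cases hi : i < n
            · have := congrFun (hsp ⟨w, hw⟩ γ) ⟨i, hi⟩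
              rw [h1 ⟨i, hi⟩, ← this]
            · rw [splice_ge (by rw [hlen]; omega)]
              have : γ (n + (i - n)) = γ1 (n + (i - n)) := h4 (i - n)
              rw [show n + (i - n) = i by omega] at this
              exact this.symm
          refine ⟨funext h1, ?_⟩
          rw [this]
          exact swap_mem hf h2 c.1 c.2.1 c.2.2.1 c.2.2.2
  rw [measure_eq_tsum_fiber μ f (fun b => fiber_meas n {b}) (TEv G o U W n s),
    measure_eq_tsum_fiber μ f (fun b => fiber_meas n {b}) (TEv G o U W n s')]
  calc ∑' w, μ (f ⁻¹' {w} ∩ TEv G o U W n s)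
      = ∑' w : R, μ (f ⁻¹' {(w : Fin n → E)} ∩ TEv G o U W n s) := by
        refine (tsum_subtype_eq_of_support_subset ?_).symm
        intro w hw
        by_contra hne
        refine hw ?_
        have : f ⁻¹' {w} ∩ TEv G o U W n s = ∅ := Set.not_nonempty_iff_eq_empty.1 hne
        change μ (f ⁻¹' {w} ∩ TEv G o U W n s) = 0
        rw [this, measure_empty]
    _ ≤ ∑' w : R, μ (f ⁻¹' {Φ w} ∩ TEv G o U W n s') := ENNReal.tsum_le_tsum hle
    _ ≤ ∑' w, μ (f ⁻¹' {w} ∩ TEv G o U W n s') :=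
        ENNReal.tsum_comp_le_tsum_of_injective hΦinj fun w => μ (f ⁻¹' {w} ∩ TEv G o U W n s')

/-- The limiting event. -/
def TEvI (G : DigraphStruct V E) (o : V) (U W : Set V) (s : V → List E) : Set (ℕ → E) :=
  {γ | Eul G o γ ∧ (∀ v ∈ U, stk G γ v = s v) ∧ UW G (LE G γ) W = U}

theorem measure_TEvI {o : V} [MeasurableSpace E] (hf : G.LocallyFinite) (μ : Measure (ℕ → E))
    {U W : Set V} (hU : U.Finite) (s : V → List E) :
    μ (TEvI G o U W s) = ⨆ n, μ (TEv G o U W n s) := by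
  have : TEvI G o U W s = ⋃ n, TEv G o U W n s := by
    ext γ
    simp only [TEvI, TEv, mem_ofPred_eq, mem_iUnion]
    constructor
    · rintro ⟨h1, h2, h3⟩
      obtain ⟨n, hn⟩ := h1.exists_done hf hU
      exact ⟨n, h1, h2, h3, hn⟩
    · rintro ⟨n, h1, h2, h3, hn⟩; exact ⟨h1, h2, h3⟩
  rw [this]
  refine Monotone.measure_iUnion ?_
  intro n m hnm γ hγ
  exact ⟨hγ.1, hγ.2.1, hγ.2.2.1, hγ.2.2.2.mono hnm⟩

theorem swap_eq [Countable E] [MeasurableSpace E] [DiscreteMeasurableSpace E] {o : V}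
    (hf : G.LocallyFinite) {μ : Measure (ℕ → E)} (hμ : ProperGibbs G o μ) {U W : Set V}
    (hU : U.Finite) (s s' : V → List E)
    (hs : ∀ v ∈ U, ValidAt G v (s v)) (harbs : IsWiredArb G U (bot G U s))
    (hs' : ∀ v ∈ U, ValidAt G v (s' v)) (harb : IsWiredArb G U (bot G U s')) :
    μ (TEvI G o U W s) = μ (TEvI G o U W s') := by
  rw [measure_TEvI hf μ hU, measure_TEvI hf μ hU]
  exact le_antisymm (iSup_mono fun n => swap_le hf hμ n s s' hs' harb)
    (iSup_mono fun n => swap_le hf hμ n s' s hs harbs)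

end swap


section count

variable {V E : Type} {G : DigraphStruct V E}

theorem exists_outList (hf : G.LocallyFinite) (v : V) :
    ∃ L : List E, ValidAt G v L ∧ L.length = G.outDeg v := by
  classical
  refine ⟨(hf v).1.toFinset.toList, ⟨Finset.nodup_toList _, fun e => ?_⟩, ?_⟩
  · simp [DigraphStruct.outEdges]
  · rw [Finset.length_toList, DigraphStruct.outDeg, Set.ncard_eq_toFinset_card _ (hf v).1]

theorem validAt_iff_perm {v : V} {L : List E} (hL : ValidAt G v L) (l : List E) :
    ValidAt G v l ↔ l.Perm L := by
  constructor
  · intro h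
    rw [List.perm_ext_iff_of_nodup h.1 hL.1]
    intro e
    rw [h.2, hL.2]
  · intro h
    exact ⟨h.nodup_iff.2 hL.1, fun e => by rw [h.mem_iff, hL.2]⟩

theorem finite_validAt (hf : G.LocallyFinite) (v : V) : {l | ValidAt G v l}.Finite := by
  classical
  obtain ⟨L, hL, -⟩ := exists_outList hf v
  refine (L.permutations.toFinset.finite_toSet).subset ?_
  intro l hl
  simp only [Finset.mem_coe, List.mem_toFinset, List.mem_permutations]
  exact (validAt_iff_perm hL l).1 hl

theorem card_validAt_last (hf : G.LocallyFinite) {v : V} {e : E} (he : G.src e = v) :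
    Nat.card {l // ValidAt G v l ∧ l.getLast? = some e} = (G.outDeg v - 1).factorial := by
  classical
  obtain ⟨L, hL, hlen⟩ := exists_outList hf v
  have heL : e ∈ L := (hL.2 e).2 he
  have h1 : (L.erase e).permutations.toFinset.card = (G.outDeg v - 1).factorial := by
    rw [List.toFinset_card_of_nodup (List.nodup_permutations _ (hL.1.erase e)),
      List.length_permutations, List.length_erase_of_mem heL, hlen]
  rw [← h1, ← Set.ncard_coe_finset, ← Set.ncard_image_of_injective _
    (f := fun l : List E => l ++ [e]) (fun a b h => List.append_cancel_right h)]
  change Nat.card ↑{l | ValidAt G v l ∧ l.getLast? = some e} = _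
  rw [Nat.card_coe_set_eq]
  congr 1
  ext l
  simp only [mem_ofPred_eq, mem_image, Finset.mem_coe, List.mem_toFinset, List.mem_permutations]
  rw [validAt_iff_perm hL, List.getLast?_eq_some_iff]
  have hp : (L.erase e ++ [e]).Perm L :=
    (List.perm_append_singleton _ _).trans (List.perm_cons_erase heL).symm
  constructor
  · rintro ⟨h, l', rfl⟩
    exact ⟨l', (List.perm_append_right_iff [e]).1 (h.trans hp.symm), rfl⟩
  · rintro ⟨l', h, rfl⟩
    exact ⟨(h.append_right [e]).trans hp, l', rfl⟩

open Classical in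
/-- Extension of a configuration on `U` by empty stacks. -/
noncomputable def ext0 (U : Finset V) (a : U → List E) : V → List E :=
  fun v => if h : v ∈ U then a ⟨v, h⟩ else []

theorem ext0_mem {U : Finset V} (a : U → List E) {v : V} (h : v ∈ U) : ext0 U a v = a ⟨v, h⟩ := by
  simp [ext0, h]

/-- Good configurations agreeing with `s` on `K`. -/
def GoodK (G : DigraphStruct V E) (U K : Finset V) (s : V → List E) (a : U → List E) : Prop :=
  (∀ v : U, ValidAt G v (a v)) ∧ IsWiredArb G (U : Set V) (bot G U (ext0 U a)) ∧
    ∀ v : U, (v : V) ∈ K → a v = s v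

theorem valid_last_src {v : V} {l : List E} (h : ValidAt G v l) {e : E} (he : l.getLast? = some e) :
    G.src e = v := (h.2 e).1 (List.mem_of_getLast? he)

theorem bot_ext0 {U : Finset V} {B : Set E} (hB : IsWiredArb G (U : Set V) B) {a : U → List E}
    (ha : ∀ v : U, ValidAt G v (a v) ∧ ∃ e ∈ B, (a v).getLast? = some e) :
    bot G U (ext0 U a) = B := by
  ext e
  simp only [bot, mem_ofPred_eq, Finset.mem_coe]
  constructor
  · rintro ⟨h1, h2⟩
    rw [ext0_mem _ h1] at h2
    obtain ⟨e', he', h'⟩ := (ha ⟨_, h1⟩).2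
    rw [h2] at h'
    cases h'
    exact he'
  · intro he
    have h1 : G.src e ∈ U := hB.1 e he
    refine ⟨h1, ?_⟩
    rw [ext0_mem _ h1]
    obtain ⟨hv, e', he', h'⟩ := (ha ⟨_, h1⟩)
    have hs := valid_last_src hv h'
    have := (hB.2.1 _ h1).unique ⟨he', hs⟩ ⟨he, rfl⟩
    rw [h', this]

theorem finite_arb (hf : G.LocallyFinite) (U : Finset V) : {B | IsWiredArb G (U : Set V) B}.Finite := by
  have h1 : {e | G.src e ∈ U}.Finite := by
    have : {e | G.src e ∈ U} = ⋃ v ∈ U, G.outEdges v := by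
      ext e; simp [DigraphStruct.outEdges]
    rw [this]
    exact U.finite_toSet.biUnion fun v _ => (hf v).1
  exact h1.finite_subsets.subset fun B hB e he => hB.1 e he

open Classical in
theorem card_goodK (hf : G.LocallyFinite) (U K : Finset V) (s : V → List E)
    (hs : ∀ v ∈ K, ValidAt G v (s v)) (F : Finset E)
    (hF : ∀ e, e ∈ F ↔ ∃ v ∈ K, (s v).getLast? = some e)
    (hF' : ∀ v ∈ K, ∃ e, (s v).getLast? = some e) (hKU : K ⊆ U) :
    Nat.card {a : U → List E // GoodK G U K s a} =
      Nat.card {B : Set E // IsWiredArb G (U : Set V) B ∧ (F : Set E) ⊆ B} *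
        ∏ v : U, (if (v : V) ∈ K then 1 else (G.outDeg v - 1).factorial) := by
  let P : {B : Set E // IsWiredArb G (U : Set V) B ∧ (F : Set E) ⊆ B} → U → List E → Prop :=
    fun B v l => (ValidAt G v l ∧ ∃ e ∈ B.1, l.getLast? = some e) ∧ ((v : V) ∈ K → l = s v)
  let Φ : (Σ B : {B : Set E // IsWiredArb G (U : Set V) B ∧ (F : Set E) ⊆ B},
      ∀ v : U, {l // P B v l}) → {a : U → List E // GoodK G U K s a} :=
    fun x => ⟨fun v => (x.2 v).1, fun v => (x.2 v).2.1.1,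
      by rw [bot_ext0 x.1.2.1 fun v => (x.2 v).2.1]; exact x.1.2.1, fun v hv => (x.2 v).2.2 hv⟩
  have hΦ : Function.Bijective Φ := by
    constructor
    · rintro ⟨B, g⟩ ⟨B', g'⟩ h
      have h' : (fun v => (g v).1) = fun v => (g' v).1 := congrArg Subtype.val h
      have hB : B = B' := by
        apply Subtype.ext
        rw [← bot_ext0 B.2.1 fun v => (g v).2.1, ← bot_ext0 B'.2.1 fun v => (g' v).2.1, h']
      subst hB
      congr 1
      funext v
      exact Subtype.ext (congrFun h' v)
    · rintro ⟨a, h1, h2, h3⟩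
      have hlast : ∀ v : U, ∃ e ∈ bot G U (ext0 U a), (a v).getLast? = some e := by
        intro v
        obtain ⟨e, ⟨he, hev⟩, -⟩ := h2.2.1 v v.2
        refine ⟨e, he, ?_⟩
        have := he.2
        rw [hev, ext0_mem _ v.2] at this
        exact this
      refine ⟨⟨⟨bot G U (ext0 U a), h2, ?_⟩, fun v => ⟨a v, ⟨h1 v, hlast v⟩, h3 v⟩⟩, rfl⟩
      intro e he
      obtain ⟨v, hv, hl⟩ := (hF e).1 he
      obtain ⟨e', he', hl'⟩ := hlast ⟨v, hKU hv⟩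
      rw [h3 ⟨v, hKU hv⟩ hv, hl] at hl'
      cases hl'
      exact he'
  have hcard : ∀ B v, Nat.card {l // P B v l} =
      if (v : V) ∈ K then 1 else (G.outDeg v - 1).factorial := by
    intro B v
    split_ifs with hv
    · rw [Nat.card_eq_one_iff_unique]
      obtain ⟨e, he⟩ := hF' v hv
      refine ⟨⟨fun x y => Subtype.ext ((x.2.2 hv).trans (y.2.2 hv).symm)⟩,
        ⟨⟨s v, ⟨hs v hv, e, B.2.2 ((hF e).2 ⟨v, hv, he⟩), he⟩, fun _ => rfl⟩⟩⟩
    · obtain ⟨e, ⟨he, hev⟩, huniq⟩ := B.2.1.2.1 v v.2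
      rw [← card_validAt_last hf hev]
      refine Nat.card_congr (Equiv.subtypeEquivRight fun l => ?_)
      constructor
      · rintro ⟨⟨h1, e', he', h2⟩, -⟩
        have := huniq e' ⟨he', valid_last_src h1 h2⟩
        exact ⟨h1, this ▸ h2⟩
      · rintro ⟨h1, h2⟩
        exact ⟨⟨h1, e, he, h2⟩, fun h => absurd h hv⟩
  have hfin : Finite {B : Set E // IsWiredArb G (U : Set V) B ∧ (F : Set E) ⊆ B} :=
    ((finite_arb hf U).subset fun B hB => hB.1).to_subtype
  have hfin2 : ∀ B, Finite (∀ v : U, {l // P B v l}) := by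
    intro B
    have : ∀ v : U, Finite {l // P B v l} := fun v =>
      ((finite_validAt hf v).subset fun l hl => hl.1.1).to_subtype
    infer_instance
  have := Fintype.ofFinite {B : Set E // IsWiredArb G (U : Set V) B ∧ (F : Set E) ⊆ B}
  rw [← Nat.card_congr (Equiv.ofBijective Φ hΦ), Nat.card_sigma]
  simp_rw [Nat.card_pi, hcard]
  rw [Finset.sum_const, smul_eq_mul, Finset.card_univ, Nat.card_eq_fintype_card]

theorem finite_goodK (hf : G.LocallyFinite) (U K : Finset V) (s : V → List E) :
    Finite {a : U → List E // GoodK G U K s a} := by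
  refine ((Set.Finite.pi (fun v : U => finite_validAt hf (v : V))).subset ?_).to_subtype
  intro a ha v _
  exact ha.1 v

end count

section meas

variable {V E : Type} {G : DigraphStruct V E}

theorem pre_congr_fin {γ γ' : ℕ → E} {n : ℕ} (h : ∀ i : Fin n, γ i = γ' i) : pre γ n = pre γ' n := by
  apply List.map_congr_left
  intro i hi
  exact h ⟨i, List.mem_range.1 hi⟩

variable [Countable E] [MeasurableSpace E] [DiscreteMeasurableSpace E]

theorem meas_of_pre (n : ℕ) (P : List E → Prop) : MeasurableSet {γ : ℕ → E | P (pre γ n)} := by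
  have := fiber_meas (E := E) n {w | P (List.ofFn w)}
  convert this using 1
  ext γ
  simp only [mem_ofPred_eq, mem_preimage]
  have : pre γ n = List.ofFn fun i : Fin n => γ i := by
    apply List.ext_getElem <;> simp [pre]
  rw [this]

theorem meas_stk (v : V) (l : List E) : MeasurableSet {γ : ℕ → E | stk G γ v = l} := by
  classical
  have hlim : ∀ l : List E, MeasurableSet {γ : ℕ → E | ∃ N, ∀ m, N ≤ m → filt G v (pre γ m) = l} := by
    intro l
    have : {γ : ℕ → E | ∃ N, ∀ m, N ≤ m → filt G v (pre γ m) = l} =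
        ⋃ N : ℕ, ⋂ m : ℕ, ⋂ _ : N ≤ m, {γ : ℕ → E | filt G v (pre γ m) = l} := by
      ext γ; simp
    rw [this]
    exact MeasurableSet.iUnion fun N => MeasurableSet.iInter fun m => MeasurableSet.iInter fun _ =>
      meas_of_pre m fun x => filt G v x = l
  have : {γ : ℕ → E | stk G γ v = l} =
      {γ : ℕ → E | ∃ N, ∀ m, N ≤ m → filt G v (pre γ m) = l} ∪
      ({γ : ℕ → E | l = []} ∩ (⋃ l' : List E, {γ : ℕ → E | ∃ N, ∀ m, N ≤ m → filt G v (pre γ m) = l'})ᶜ) := by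
    ext γ
    simp only [mem_ofPred_eq, mem_union, mem_inter_iff, mem_compl_iff, mem_iUnion]
    by_cases h : ∃ l', ∃ N, ∀ m, N ≤ m → filt G v (pre γ m) = l'
    · obtain ⟨l', h'⟩ := h
      rw [stk_eq h']
      constructor
      · rintro rfl; exact Or.inl h'
      · rintro (h2 | h2)
        · rw [← stk_eq h', stk_eq h2]
        · exact absurd ⟨l', h'⟩ h2.2
    · have h0 : stk G γ v = [] := by
        unfold stk; rw [dif_neg h]
      rw [h0]
      constructor
      · rintro rfl; exact Or.inr ⟨rfl, h⟩
      · rintro (h2 | h2)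
        · exact absurd ⟨l, h2⟩ h
        · exact h2.1.symm
  rw [this]
  exact (hlim l).union ((MeasurableSet.const _).inter (MeasurableSet.iUnion hlim).compl)

theorem meas_stk_set (v : V) (C : Set (List E)) : MeasurableSet {γ : ℕ → E | stk G γ v ∈ C} := by
  have : {γ : ℕ → E | stk G γ v ∈ C} = ⋃ l ∈ C, {γ : ℕ → E | stk G γ v = l} := by
    ext γ; simp
  rw [this]
  exact MeasurableSet.biUnion (Set.to_countable C) fun l _ => meas_stk v l

theorem meas_LE (e : E) : MeasurableSet {γ : ℕ → E | e ∈ LE G γ} :=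
  meas_stk_set (G := G) (G.src e) {l | l.getLast? = some e}

theorem rtg_iff (A : Set E) (u v : V) :
    Relation.ReflTransGen (G.step A) u v ↔ ∃ l : List E, IsPathList G u v l ∧ ∀ e ∈ l, e ∈ A := by
  constructor
  · intro h
    induction h using Relation.ReflTransGen.head_induction_on with
    | refl => exact ⟨[], rfl, by simp⟩
    | head h1 _ ih =>
      obtain ⟨e, he, h2, h3⟩ := h1
      obtain ⟨l, hl, hl'⟩ := ih
      refine ⟨e :: l, ⟨h2, h3 ▸ hl⟩, ?_⟩
      simpa using ⟨he, hl'⟩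
  · rintro ⟨l, hl, hl'⟩
    induction l generalizing u with
    | nil => cases hl; exact Relation.ReflTransGen.refl
    | cons e l ih =>
      refine Relation.ReflTransGen.head ⟨e, hl' e (by simp), hl.1, rfl⟩
        (ih _ hl.2 fun e' he' => hl' e' (by simp [he']))

theorem meas_rtg (u v : V) :
    MeasurableSet {γ : ℕ → E | Relation.ReflTransGen (G.step (LE G γ)) u v} := by
  have : {γ : ℕ → E | Relation.ReflTransGen (G.step (LE G γ)) u v} =
      ⋃ l ∈ {l | IsPathList G u v l}, ⋂ e : E, ⋂ _ : e ∈ l, {γ : ℕ → E | e ∈ LE G γ} := by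
    ext γ
    simp only [mem_ofPred_eq, rtg_iff, mem_iUnion, mem_iInter, exists_prop]
  rw [this]
  exact MeasurableSet.biUnion (Set.to_countable _) fun l _ => MeasurableSet.iInter fun e =>
    MeasurableSet.iInter fun _ => meas_LE e

theorem meas_mem_UW [Countable V] (W : Set V) (v : V) :
    MeasurableSet {γ : ℕ → E | v ∈ UW G (LE G γ) W} := by
  have : {γ : ℕ → E | v ∈ UW G (LE G γ) W} =
      {γ : ℕ → E | v ∈ W} ∩ ⋂ u : V, ({γ : ℕ → E | Relation.ReflTransGen (G.step (LE G γ)) u v}ᶜ ∪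
        {γ : ℕ → E | u ∈ W}) := by
    ext γ
    simp only [UW, mem_ofPred_eq, mem_inter_iff, mem_iInter, mem_union, mem_compl_iff, imp_iff_not_or]
  rw [this]
  exact (MeasurableSet.const _).inter (MeasurableSet.iInter fun u =>
    (meas_rtg u v).compl.union (MeasurableSet.const _))

theorem meas_UW [Countable V] (W U : Set V) : MeasurableSet {γ : ℕ → E | UW G (LE G γ) W = U} := by
  have : {γ : ℕ → E | UW G (LE G γ) W = U} =
      ⋂ v : V, (({γ : ℕ → E | v ∈ UW G (LE G γ) W} ∩ {γ : ℕ → E | v ∈ U}) ∪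
        ({γ : ℕ → E | v ∈ UW G (LE G γ) W}ᶜ ∩ {γ : ℕ → E | v ∉ U})) := by
    ext γ
    simp only [mem_ofPred_eq, mem_inter_iff, mem_iInter, mem_union, mem_compl_iff, Set.ext_iff,
      iff_iff_and_or_not_and_not]
  rw [this]
  exact MeasurableSet.iInter fun v => ((meas_mem_UW W v).inter (MeasurableSet.const _)).union
    ((meas_mem_UW W v).compl.inter (MeasurableSet.const _))

theorem eul_compl_null {o : V} {μ : Measure (ℕ → E)} (hμ : ProperGibbs G o μ) :
    μ {γ | ¬ Eul G o γ} = 0 := by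
  have hset : {γ : ℕ → E | Eul G o γ} = {γ | (∀ i : ℕ, G.dst (γ i) = G.src (γ (i + 1))) ∧
      G.src (γ 0) = o ∧ Function.Bijective γ} := by
    ext γ
    exact ⟨fun h => ⟨h.path, h.start, h.bij⟩, fun h => ⟨h.1, h.2.1, h.2.2⟩⟩
  have hpt : ∀ i (C : Set E), MeasurableSet {γ : ℕ → E | γ i ∈ C} := fun i C =>
    (measurable_pi_apply i) MeasurableSet.of_discrete
  have hm : MeasurableSet {γ : ℕ → E | Eul G o γ} := by
    have : {γ : ℕ → E | Eul G o γ} =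
        (⋂ i : ℕ, {γ | G.dst (γ i) = G.src (γ (i + 1))}) ∩ ({γ | γ 0 ∈ {e | G.src e = o}} ∩
          ((⋂ i : ℕ, ⋂ j : ℕ, ({γ | γ i = γ j}ᶜ ∪ {γ | i = j})) ∩
            ⋂ e : E, ⋃ i : ℕ, {γ | γ i ∈ ({e} : Set E)})) := by
      rw [hset]
      ext γ
      simp only [Function.Bijective, Function.Injective, Function.Surjective, mem_ofPred_eq,
        mem_inter_iff, mem_iInter, mem_union, mem_compl_iff, mem_iUnion, imp_iff_not_or,
        mem_singleton_iff]
    rw [this]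
    have h2 : ∀ (i j : ℕ) (R : E → E → Prop), MeasurableSet {γ : ℕ → E | R (γ i) (γ j)} := by
      intro i j R
      have : {γ : ℕ → E | R (γ i) (γ j)} = ⋃ e : E, ({γ | γ i ∈ ({e} : Set E)} ∩ {γ | γ j ∈ {e' | R e e'}}) := by
        ext γ; simp
      rw [this]
      exact MeasurableSet.iUnion fun e => (hpt i _).inter (hpt j _)
    exact (MeasurableSet.iInter fun i => h2 _ _ fun a b => G.dst a = G.src b).inter ((hpt 0 _).inter
      ((MeasurableSet.iInter fun i => MeasurableSet.iInter fun j =>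
        (h2 i j fun a b => a = b).compl.union (MeasurableSet.const _)).inter
        (MeasurableSet.iInter fun e => MeasurableSet.iUnion fun i => hpt i _)))
  have h1 : μ {γ : ℕ → E | Eul G o γ} = 1 := by rw [hset]; exact hμ.2.1
  have : {γ : ℕ → E | ¬ Eul G o γ} = {γ : ℕ → E | Eul G o γ}ᶜ := rfl
  rw [this, measure_compl hm (by rw [h1]; simp), hμ.1, h1, tsub_self]

end meas

section perU

variable {V E : Type} {G : DigraphStruct V E}
variable [Countable V] [Countable E] [MeasurableSpace E] [DiscreteMeasurableSpace E]

/-- The event that the Eulerian path has maximal past-closed subset of `W` equal to `U`. -/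
def UEv (G : DigraphStruct V E) (o : V) (U W : Set V) : Set (ℕ → E) :=
  {γ | Eul G o γ ∧ UW G (LE G γ) W = U}

theorem tsum_goodK {o : V} (hG : G.IsSourcedEulerian o) {μ : Measure (ℕ → E)}
    (hμ : ProperGibbs G o μ) (U : Finset V) (W : Set V) :
    ∃ c : ℝ≥0∞, ∀ (K : Finset V) (s : V → List E), K ⊆ U →
      μ (UEv G o U W ∩ {γ | ∀ v ∈ K, stk G γ v = s v}) =
        (Nat.card {a : U → List E // GoodK G U K s a} : ℝ≥0∞) * c := by
  classical
  have hf := hG.locFin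
  have hc : ∃ c : ℝ≥0∞, ∀ a : U → List E, GoodK G U ∅ (fun _ => []) a →
      μ (TEvI G o U W (ext0 U a)) = c := by
    by_cases h : ∃ a0 : U → List E, GoodK G U ∅ (fun _ => []) a0
    · obtain ⟨a0, h0⟩ := h
      refine ⟨μ (TEvI G o U W (ext0 U a0)), fun a ha => ?_⟩
      refine swap_eq hf hμ U.finite_toSet _ _ (fun v hv => ?_) ha.2.1 (fun v hv => ?_) h0.2.1
      · rw [ext0_mem _ hv]; exact ha.1 ⟨v, hv⟩
      · rw [ext0_mem _ hv]; exact h0.1 ⟨v, hv⟩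
    · exact ⟨0, fun a ha => absurd ⟨a, ha⟩ h⟩
  obtain ⟨c, hc⟩ := hc
  refine ⟨c, fun K s hKU => ?_⟩
  let f : (ℕ → E) → (U → List E) := fun γ v => stk G γ v
  have hmf : ∀ a, MeasurableSet (f ⁻¹' {a}) := by
    intro a
    have : f ⁻¹' {a} = ⋂ v : U, {γ : ℕ → E | stk G γ v = a v} := by
      ext γ
      simp only [mem_preimage, mem_singleton_iff, mem_iInter, mem_ofPred_eq, funext_iff, f]
    rw [this]
    exact MeasurableSet.iInter fun v => meas_stk _ _
  rw [measure_eq_tsum_fiber μ f hmf]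
  have hterm : ∀ a, μ (f ⁻¹' {a} ∩ (UEv G o U W ∩ {γ | ∀ v ∈ K, stk G γ v = s v})) =
      if GoodK G U K s a then c else 0 := by
    intro a
    split_ifs with ha
    · rw [← hc a ⟨ha.1, ha.2.1, fun v hv => absurd hv (by simp)⟩]
      congr 1
      ext γ
      simp only [TEvI, UEv, mem_inter_iff, mem_preimage, mem_singleton_iff, mem_ofPred_eq, f]
      constructor
      · rintro ⟨h1, ⟨h2, h3⟩, -⟩
        refine ⟨h2, fun v hv => ?_, h3⟩
        rw [ext0_mem _ hv, ← h1]
      · rintro ⟨h1, h2, h3⟩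
        have h4 : ∀ v : U, stk G γ v = a v := fun v => by rw [h2 v v.2, ext0_mem _ v.2]
        refine ⟨funext h4, ⟨h1, h3⟩, fun v hv => ?_⟩
        rw [← ha.2.2 ⟨v, hKU hv⟩ hv, ← h4]
    · have : f ⁻¹' {a} ∩ (UEv G o U W ∩ {γ | ∀ v ∈ K, stk G γ v = s v}) = ∅ := by
        rw [Set.eq_empty_iff_forall_notMem]
        rintro γ ⟨h1, ⟨h2, h3⟩, h4⟩
        have h1 : f γ = a := h1
        apply ha
        refine ⟨fun v => ?_, ?_, fun v hv => ?_⟩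
        · rw [← h1]; exact h2.stk_valid hf v
        · have : bot G U (ext0 U a) = bot G U (stk G γ) := by
            ext e
            simp only [bot, mem_ofPred_eq, Finset.mem_coe]
            refine and_congr_right fun he => ?_
            rw [ext0_mem _ he, ← h1]
          rw [this]
          exact h2.bot_arb hG U.finite_toSet
        · rw [← h1]; exact h4 v hv
      rw [this, measure_empty]
  simp_rw [hterm]
  have hfin := finite_goodK hf U K s
  have := Fintype.ofFinite {a : U → List E // GoodK G U K s a}
  have h1 : ∑' a, (if GoodK G U K s a then c else 0) =
      ∑' a : {a | GoodK G U K s a}, c := by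
    rw [← tsum_subtype_eq_of_support_subset (s := {a | GoodK G U K s a})]
    · exact tsum_congr fun a => if_pos a.2
    · intro a ha
      by_contra h
      exact ha (if_neg h)
  rw [h1, ENNReal.tsum_const]
  congr 1
  change ((ENat.card {a : U → List E // GoodK G U K s a} : ℕ∞) : ℝ≥0∞) = _
  rw [ENat.card_eq_coe_natCard]
  simp

theorem perU {o : V} (hG : G.IsSourcedEulerian o) {μ : Measure (ℕ → E)}
    (hμ : ProperGibbs G o μ) (U K : Finset V) (W : Set V) (s : V → List E) (hKU : K ⊆ U)
    (hs : ∀ v ∈ K, ValidAt G v (s v)) (F : Finset E)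
    (hF : ∀ e, e ∈ F ↔ ∃ v ∈ K, (s v).getLast? = some e)
    (hF' : ∀ v ∈ K, ∃ e, (s v).getLast? = some e) :
    μ (UEv G o U W ∩ {γ | ∀ v ∈ K, stk G γ v = s v}) =
      μ (UEv G o U W) * wiredUACyl G U F * ∏ v ∈ K, (((G.outDeg v - 1).factorial : ℝ≥0∞))⁻¹ := by
  classical
  obtain ⟨c, hc⟩ := tsum_goodK hG hμ U W
  have h1 := hc K s hKU
  have h2 := hc ∅ s (by simp)
  simp only [Finset.notMem_empty, false_imp_iff, implies_true, ofPred_true, inter_univ] at h2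
  rw [h1, h2, card_goodK hG.locFin U K s hs F hF hF' hKU,
    card_goodK hG.locFin U ∅ s (by simp) ∅ (by simp) (by simp) (by simp)]
  have hA : Nat.card {B : Set E // IsWiredArb G (U : Set V) B ∧ ((∅ : Finset E) : Set E) ⊆ B} =
      Nat.card {B : Set E // IsWiredArb G (U : Set V) B} :=
    Nat.card_congr (Equiv.subtypeEquivRight fun B => by simp)
  rw [hA]
  unfold wiredUACyl
  have hfin : Finite {B : Set E // IsWiredArb G (U : Set V) B} := (finite_arb hG.locFin U).to_subtype
  have hle : Nat.card {B : Set E // IsWiredArb G (U : Set V) B ∧ (F : Set E) ⊆ B} ≤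
      Nat.card {B : Set E // IsWiredArb G (U : Set V) B} :=
    Nat.card_le_card_of_injective (fun B => ⟨B.1, B.2.1⟩) (fun a b h => Subtype.ext (Subtype.mk.inj h))
  generalize Nat.card {B : Set E // IsWiredArb G (U : Set V) B ∧ (F : Set E) ⊆ B} = AF at *
  generalize Nat.card {B : Set E // IsWiredArb G (U : Set V) B} = A at *
  have hprod : (∏ v : U, (if (v : V) ∈ (∅ : Finset V) then 1 else (G.outDeg v - 1).factorial)) =
      (∏ v : U, (if (v : V) ∈ K then 1 else (G.outDeg v - 1).factorial)) *
        ∏ v ∈ K, (G.outDeg v - 1).factorial := by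
    rw [Finset.prod_coe_sort U (fun v => if v ∈ K then 1 else (G.outDeg v - 1).factorial),
      Finset.prod_coe_sort U (fun v => if v ∈ (∅ : Finset V) then 1 else (G.outDeg v - 1).factorial),
      ← Finset.prod_sdiff hKU, ← Finset.prod_sdiff hKU]
    simp only [Finset.notMem_empty, if_false]
    rw [Finset.prod_congr rfl (g := fun v => (G.outDeg v - 1).factorial) (s₁ := U \ K)
      (f := fun v => if v ∈ K then 1 else (G.outDeg v - 1).factorial)
      fun v hv => if_neg (Finset.mem_sdiff.1 hv).2,
      Finset.prod_eq_one (s := K) (f := fun v => if v ∈ K then 1 else (G.outDeg v - 1).factorial)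
      fun v hv => if_pos hv, mul_one]
  rw [hprod]
  have hinv : (∏ v ∈ K, (((G.outDeg v - 1).factorial : ℝ≥0∞))⁻¹) =
      ((∏ v ∈ K, (G.outDeg v - 1).factorial : ℕ) : ℝ≥0∞)⁻¹ := by
    push_cast
    rw [ENNReal.prod_inv_distrib]
    intro i _ j _ _
    left
    simp [Nat.factorial_ne_zero]
  rw [hinv]
  have hq0 : (∏ v ∈ K, (G.outDeg v - 1).factorial) ≠ 0 :=
    Finset.prod_ne_zero_iff.2 fun v _ => Nat.factorial_ne_zero _
  generalize (∏ v ∈ K, (G.outDeg v - 1).factorial) = q at *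
  generalize (∏ v : U, (if (v : V) ∈ K then 1 else (G.outDeg v - 1).factorial)) = p at *
  by_cases hA0 : A = 0
  · have : AF = 0 := by omega
    simp [this, hA0]
  · push_cast
    have hAA : (A : ℝ≥0∞) * (A : ℝ≥0∞)⁻¹ = 1 :=
      ENNReal.mul_inv_cancel (by exact_mod_cast hA0) (by simp)
    have hqq : (q : ℝ≥0∞) * (q : ℝ≥0∞)⁻¹ = 1 :=
      ENNReal.mul_inv_cancel (by exact_mod_cast hq0) (by simp)
    rw [div_eq_mul_inv]
    calc (AF : ℝ≥0∞) * p * c = AF * p * c * (A * (A : ℝ≥0∞)⁻¹) * (q * (q : ℝ≥0∞)⁻¹) := by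
          rw [hAA, hqq, mul_one, mul_one]
      _ = _ := by ring

end perU

section limit

variable {V E : Type} {G : DigraphStruct V E}

theorem wired_tendsto [Countable V] {o : V} {κ : Measure (E → Bool)} (hκ : IsWUALaw G κ)
    (F : Finset E) : Tendsto (fun U : Finset V => wiredUACyl G (U : Set V) F) atTop
      (nhds (κ {A | ∀ e ∈ F, A e = true})) := by
  classical
  have : Nonempty V := ⟨o⟩
  by_contra hcon
  rw [Filter.not_tendsto_iff_exists_frequently_notMem] at hcon
  obtain ⟨N, hN, hfr⟩ := hcon
  rw [Filter.frequently_atTop] at hfr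
  choose g hg1 hg2 using hfr
  obtain ⟨v, hv⟩ := exists_surjective_nat V
  obtain ⟨U, hU0, hU⟩ : ∃ U : ℕ → Finset V, U 0 = g ∅ ∧ ∀ n, U (n + 1) = g (insert (v n) (U n)) :=
    ⟨fun n => Nat.rec (g ∅) (fun n Un => g (insert (v n) Un)) n, rfl, fun _ => rfl⟩
  have hbad : ∀ n : ℕ, wiredUACyl G (U n : Set V) F ∉ N := by
    intro n
    cases n with
    | zero => rw [hU0]; exact hg2 _
    | succ n => rw [hU]; exact hg2 _
  have hstep : ∀ n, insert (v n) (U n) ⊆ U (n + 1) := fun n => by rw [hU]; exact hg1 _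
  have hex : IsExhaustion fun n => ((U n : Finset V) : Set V) := by
    refine ⟨fun n => Finset.finite_toSet _, fun n x hx => ?_, ?_⟩
    · exact hstep n (Finset.mem_insert_of_mem hx)
    · rw [Set.eq_univ_iff_forall]
      intro x
      obtain ⟨n, rfl⟩ := hv x
      exact mem_iUnion.2 ⟨n + 1, hstep n (Finset.mem_insert_self _ _)⟩
  have := (hκ.2 _ hex F).eventually_mem hN
  obtain ⟨n, hn⟩ := this.exists
  exact hbad n hn

variable [Countable V] [Countable E] [MeasurableSpace E] [DiscreteMeasurableSpace E]

/-- The event that the path is Eulerian and the past-closed part of `W` contains `K`. -/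
def HEv (G : DigraphStruct V E) (o : V) (K W : Set V) : Set (ℕ → E) :=
  {γ | Eul G o γ ∧ K ⊆ UW G (LE G γ) W}

theorem exists_eul {o : V} {μ : Measure (ℕ → E)} (hμ : ProperGibbs G o μ) : ∃ γ, Eul G o γ := by
  by_contra h
  push Not at h
  have h1 := eul_compl_null hμ
  have : {γ : ℕ → E | ¬ Eul G o γ} = univ := by
    rw [Set.eq_univ_iff_forall]; exact h
  rw [this, hμ.1] at h1
  exact one_ne_zero h1

theorem HEv_sup {o : V} (hG : G.IsSourcedEulerian o) {μ : Measure (ℕ → E)}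
    (hμ : ProperGibbs G o μ) (v : ℕ → V) (hv : Function.Surjective v) (K : Finset V)
    (D : Set (ℕ → E)) [DecidableEq V] :
    ⨆ n, μ (HEv G o K ((Finset.range n).image v : Finset V) ∩ D) = μ D := by
  rw [← Monotone.measure_iUnion]
  · refine le_antisymm (measure_mono (iUnion_subset fun n => inter_subset_right)) ?_
    have hsub : D ⊆ (⋃ n, HEv G o K ((Finset.range n).image v : Finset V) ∩ D) ∪
        {γ | ¬ Eul G o γ} := by
      intro γ hγ
      by_cases hE : Eul G o γ
      · left
        have hfin : (⋃ x ∈ K, {u | Relation.ReflTransGen (G.step (LE G γ)) u x}).Finite :=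
          K.finite_toSet.biUnion fun x _ => hE.past_finite hG x
        choose i hi using hv
        obtain ⟨n, hn⟩ := (hfin.image i).bddAbove
        refine mem_iUnion.2 ⟨n + 1, ⟨hE, ?_⟩, hγ⟩
        have key : ∀ x ∈ K, ∀ u, Relation.ReflTransGen (G.step (LE G γ)) u x →
            u ∈ (((Finset.range (n + 1)).image v : Finset V) : Set V) := by
          intro x hx u hu
          have : i u ≤ n := hn ⟨u, mem_biUnion hx hu, rfl⟩
          simp only [Finset.coe_image, mem_image, Finset.coe_range, mem_Iio]
          exact ⟨i u, by omega, hi u⟩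
        intro x hx
        exact ⟨key x hx x Relation.ReflTransGen.refl, key x hx⟩
      · right; exact hE
    refine (measure_mono hsub).trans ((measure_union_le _ _).trans ?_)
    rw [eul_compl_null hμ, add_zero]
  · intro n m hnm γ hγ
    refine ⟨⟨hγ.1.1, fun x hx => ?_⟩, hγ.2⟩
    have hmono : (((Finset.range n).image v : Finset V) : Set V) ⊆
        (((Finset.range m).image v : Finset V) : Set V) := by
      exact_mod_cast Finset.image_subset_image (Finset.range_mono hnm)
    have := hγ.1.2 hx
    exact ⟨hmono this.1, fun u hu => hmono (this.2 u hu)⟩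

theorem stk_law {o : V} (hG : G.IsSourcedEulerian o) {μ : Measure (ℕ → E)}
    (hμ : ProperGibbs G o μ) {κ : Measure (E → Bool)} (hκ : IsWUALaw G κ)
    (K : Finset V) (s : V → List E) (hs : ∀ v ∈ K, ValidAt G v (s v)) :
    μ {γ | ∀ v ∈ K, stk G γ v = s v} =
      κ {A | ∀ v ∈ K, ∃ e : E, (s v).getLast? = some e ∧ A e = true} *
            ∏ v ∈ K, (((G.outDeg v - 1).factorial : ℝ≥0∞))⁻¹ := by
  classical
  obtain ⟨γ0, hγ0⟩ := exists_eul hμ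
  have hF' : ∀ v ∈ K, ∃ e, (s v).getLast? = some e := by
    intro v hv
    obtain ⟨i, hi⟩ := hγ0.exists_visit hG v
    have : γ0 i ∈ s v := ((hs v hv).2 _).2 hi
    have hne : s v ≠ [] := List.ne_nil_of_mem this
    exact ⟨_, List.getLast?_eq_some_getLast hne⟩
  let F : Finset E := K.biUnion fun v => (s v).getLast?.toFinset
  have hF : ∀ e, e ∈ F ↔ ∃ v ∈ K, (s v).getLast? = some e := by
    intro e
    simp [F]
  have hκset : {A : E → Bool | ∀ v ∈ K, ∃ e : E, (s v).getLast? = some e ∧ A e = true} =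
      {A | ∀ e ∈ F, A e = true} := by
    ext A
    simp only [mem_ofPred_eq]
    constructor
    · intro h e he
      obtain ⟨v, hv, hl⟩ := (hF e).1 he
      obtain ⟨e', h1, h2⟩ := h v hv
      rw [hl] at h1
      cases h1
      exact h2
    · intro h v hv
      obtain ⟨e, he⟩ := hF' v hv
      exact ⟨e, he, h e ((hF e).2 ⟨v, hv, he⟩)⟩
  rw [hκset]
  have htend := wired_tendsto (o := o) hκ F
  set c := κ {A | ∀ e ∈ F, A e = true} with hc
  have hcfin : c ≠ ∞ := by
    refine ne_top_of_le_ne_top ENNReal.one_ne_top ?_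
    rw [← hκ.1]
    exact measure_mono (subset_univ _)
  set q : ℝ≥0∞ := ∏ v ∈ K, (((G.outDeg v - 1).factorial : ℝ≥0∞))⁻¹ with hq
  have hq1 : q ≤ 1 := by
    refine Finset.prod_le_one' fun v _ => ?_
    rw [ENNReal.inv_le_one]
    exact_mod_cast Nat.factorial_pos _
  set D : Set (ℕ → E) := {γ | ∀ v ∈ K, stk G γ v = s v} with hD
  have : Nonempty V := ⟨o⟩
  obtain ⟨v, hv⟩ := exists_surjective_nat V
  -- fibers
  have hfib : ∀ (W : Finset V), ∃ f : (ℕ → E) → Finset V, (∀ U, MeasurableSet (f ⁻¹' {U})) ∧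
      ∀ γ U, f γ = U ↔ UW G (LE G γ) W = (U : Set V) := by
    intro W
    have hkey : ∀ γ U, (W.filter fun x => x ∈ UW G (LE G γ) W) = U ↔
        UW G (LE G γ) W = (U : Set V) := by
      intro γ U
      rw [← Finset.coe_inj]
      have : ((W.filter fun x => x ∈ UW G (LE G γ) W : Finset V) : Set V) = UW G (LE G γ) W := by
        ext x
        simp only [Finset.coe_filter, mem_ofPred_eq]
        exact ⟨fun h => h.2, fun h => ⟨h.1, h⟩⟩
      rw [this]
    refine ⟨fun γ => W.filter fun x => x ∈ UW G (LE G γ) W, fun U => ?_, hkey⟩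
    convert meas_UW (G := G) (W : Set V) (U : Set V) using 1
    ext γ
    exact hkey γ U
  -- main estimate
  have hmain : ∀ ε : ℝ≥0∞, 0 < ε → ∃ K1 : Finset V, ∀ W : Finset V,
      μ (HEv G o K1 W ∩ D) ≤ μ (HEv G o K1 W) * ((c + ε) * q) ∧
      μ (HEv G o K1 W) * (c * q) ≤ μ (HEv G o K1 W ∩ D) + μ (HEv G o K1 W) * ε := by
    intro ε hε
    have hev : ∀ᶠ U : Finset V in atTop, wiredUACyl G (U : Set V) F ∈ Icc (c - ε) (c + ε) :=
      htend.eventually_mem (ENNReal.Icc_mem_nhds hcfin hε.ne')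
    obtain ⟨K0, hK0⟩ := Filter.eventually_atTop.1 hev
    refine ⟨K ∪ K0, fun W => ?_⟩
    obtain ⟨f, hfm, hf⟩ := hfib W
    have hU : ∀ U : Finset V, ∃ p x : ℝ≥0∞, μ (f ⁻¹' {U} ∩ HEv G o (K ∪ K0 : Finset V) W) = p ∧
        μ (f ⁻¹' {U} ∩ (HEv G o (K ∪ K0 : Finset V) W ∩ D)) = p * x * q ∧
        c - ε ≤ x ∧ x ≤ c + ε := by
      intro U
      by_cases hKU : K ∪ K0 ⊆ U
      · have hset : f ⁻¹' {U} ∩ HEv G o (K ∪ K0 : Finset V) W = UEv G o U W := by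
          ext γ
          simp only [mem_inter_iff, mem_preimage, mem_singleton_iff, hf, HEv, UEv, mem_ofPred_eq]
          constructor
          · rintro ⟨h1, h2, -⟩; exact ⟨h2, h1⟩
          · rintro ⟨h1, h2⟩
            refine ⟨h2, h1, ?_⟩
            rw [h2]
            exact_mod_cast hKU
        refine ⟨μ (UEv G o U W), wiredUACyl G (U : Set V) F, by rw [hset], ?_, ?_⟩
        · rw [← inter_assoc, hset]
          exact perU hG hμ U K W s (Finset.union_subset_left hKU) hs F hF hF'
        · exact hK0 U (Finset.union_subset_right hKU)
      · have hset : f ⁻¹' {U} ∩ HEv G o (K ∪ K0 : Finset V) W = ∅ := by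
          rw [Set.eq_empty_iff_forall_notMem]
          rintro γ ⟨h1, h2, h3⟩
          have h1 := (hf γ U).1 h1
          rw [h1] at h3
          exact hKU (by exact_mod_cast h3)
        refine ⟨0, c, by rw [hset, measure_empty], ?_, tsub_le_self, le_self_add⟩
        rw [← inter_assoc, hset]
        simp
    rw [measure_eq_tsum_fiber μ f hfm (HEv G o (K ∪ K0 : Finset V) W ∩ D),
      measure_eq_tsum_fiber μ f hfm (HEv G o (K ∪ K0 : Finset V) W)]
    rw [← ENNReal.tsum_mul_right, ← ENNReal.tsum_mul_right, ← ENNReal.tsum_mul_right,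
      ← ENNReal.tsum_add]
    constructor
    · refine ENNReal.tsum_le_tsum fun U => ?_
      obtain ⟨p, x, h1, h2, h3, h4⟩ := hU U
      rw [h1, h2, mul_assoc]
      gcongr
    · refine ENNReal.tsum_le_tsum fun U => ?_
      obtain ⟨p, x, h1, h2, h3, h4⟩ := hU U
      rw [h1, h2, mul_assoc, ← mul_add]
      have : c ≤ x + ε := tsub_le_iff_right.1 h3
      gcongr
      calc c * q ≤ (x + ε) * q := by gcongr
        _ = x * q + ε * q := add_mul _ _ _
        _ ≤ x * q + ε * 1 := by gcongr
        _ = _ := by rw [mul_one]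
  have hle1 : ∀ A : Set (ℕ → E), μ A ≤ 1 := fun A => by
    rw [← hμ.1]; exact measure_mono (subset_univ _)
  apply le_antisymm
  · refine ENNReal.le_of_forall_pos_le_add fun ε hε _ => ?_
    obtain ⟨K1, hK1⟩ := hmain ε (by exact_mod_cast hε)
    rw [← HEv_sup hG hμ v hv K1 D]
    refine iSup_le fun n => ((hK1 _).1).trans ?_
    calc _ ≤ 1 * ((c + ε) * q) := by gcongr; exact hle1 _
      _ = c * q + ε * q := by ring
      _ ≤ c * q + ε * 1 := by gcongr
      _ = _ := by rw [mul_one]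
  · refine ENNReal.le_of_forall_pos_le_add fun ε hε _ => ?_
    obtain ⟨K1, hK1⟩ := hmain ε (by exact_mod_cast hε)
    have h1 := HEv_sup hG hμ v hv K1 univ
    rw [hμ.1] at h1
    simp only [inter_univ] at h1
    calc c * q = (⨆ n, μ (HEv G o K1 ((Finset.range n).image v : Finset V))) * (c * q) := by
          rw [h1, one_mul]
      _ = ⨆ n, μ (HEv G o K1 ((Finset.range n).image v : Finset V)) * (c * q) := ENNReal.iSup_mul _ _
      _ ≤ μ D + ε := by
          refine iSup_le fun n => ((hK1 _).2).trans ?_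
          gcongr
          · exact inter_subset_right
          · calc _ ≤ 1 * (ε : ℝ≥0∞) := by gcongr; exact hle1 _
              _ = ε := one_mul _

end limit

section final

variable {V E : Type} {G : DigraphStruct V E}

/-- Following the stacks produces the list `l`. -/
def Follows (G : DigraphStruct V E) (o : V) (σ : V → List E) (l : List E) : Prop :=
  ∀ i < l.length, stackEdge G o σ i = l[i]?

theorem Follows.left {o : V} {σ : V → List E} {l : List E} {e : E}
    (h : Follows G o σ (l ++ [e])) : Follows G o σ l ∧ stackEdge G o σ l.length = some e := by
  constructor
  · intro i hi
    rw [h i (by simp; omega), List.getElem?_append_left hi]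
  · rw [h l.length (by simp)]
    simp

theorem follows_state {o : V} {σ : V → List E} (hσ : ∀ v, ∀ e ∈ σ v, G.src e = v) {l : List E}
    (h : Follows G o σ l) :
    IsPathList G o (stackState G o σ l.length).1 l ∧
      ∀ v, σ v = filt G v l ++ (stackState G o σ l.length).2 v := by
  classical
  induction l using List.reverseRecOn with
  | nil => exact ⟨rfl, fun v => by simp [filt_nil, stackState]⟩
  | append_singleton l e ih =>
    obtain ⟨h1, h2⟩ := h.left
    obtain ⟨h3, h4⟩ := ih h1
    have hlen : (l ++ [e]).length = l.length + 1 := by simp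
    rw [hlen]
    generalize hp : stackState G o σ l.length = p at *
    have h5 : (p.2 p.1).head? = some e := by
      rw [← h2]; simp only [stackEdge, hp]
    obtain ⟨rest, hrest⟩ : ∃ rest, p.2 p.1 = e :: rest := by
      cases hx : p.2 p.1 with
      | nil => rw [hx] at h5; simp at h5
      | cons a b => rw [hx] at h5; simp at h5; exact ⟨b, by rw [h5]⟩
    have hst : stackState G o σ (l.length + 1) = (G.dst e, Function.update p.2 p.1 rest) := by
      simp only [stackState, hp, hrest]
    have hsrc : G.src e = p.1 := hσ p.1 e (by rw [h4 p.1, hrest]; simp)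
    rw [hst]
    refine ⟨?_, fun v => ?_⟩
    · rw [pathList_append]
      exact ⟨p.1, h3, hsrc, rfl⟩
    · rw [filt_append]
      by_cases hv : v = p.1
      · subst hv
        rw [h4 p.1, hrest]
        have := filt_cons_self (G := G) e []
        rw [hsrc, filt_nil] at this
        rw [this]
        simp
      · rw [filt_cons_ne (by rw [hsrc]; exact fun h => hv h.symm), filt_nil]
        rw [h4 v]
        simp [Function.update_of_ne hv]

theorem follows_of_prefix {o z : V} {σ : V → List E} (hσ : ∀ v, ∀ e ∈ σ v, G.src e = v) {l : List E}
    (hl : IsPathList G o z l) (h : ∀ v, filt G v l <+: σ v) : Follows G o σ l := by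
  induction l using List.reverseRecOn generalizing z with
  | nil => intro i hi; simp at hi
  | append_singleton l e ih =>
    rw [pathList_append] at hl
    obtain ⟨y, hy, hsrc, -⟩ := hl
    have h1 : Follows G o σ l := ih hy fun v => by
      have := h v
      rw [filt_append] at this
      exact (List.prefix_append _ _).trans this
    obtain ⟨h3, h4⟩ := follows_state hσ h1
    have hyy := pathList_unique hy h3
    have hedge : stackEdge G o σ l.length = some e := by
      have := h y
      rw [filt_append] at this
      have h5 := filt_cons_self (G := G) e []
      rw [hsrc, filt_nil] at h5
      rw [h5, h4 y] at this
      have h6 := (List.prefix_append_right_inj _).1 this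
      unfold stackEdge
      rw [← hyy]
      obtain ⟨t, ht⟩ := h6
      rw [← ht]
      simp
    intro i hi
    by_cases hi' : i < l.length
    · rw [h1 i hi', List.getElem?_append_left hi']
    · have : i = l.length := by simp at hi; omega
      subst this
      rw [hedge]; simp

theorem pre_eq_ofFn {n : ℕ} (γ : ℕ → E) (w : Fin n → E) :
    (∀ i : Fin n, γ i = w i) ↔ pre γ n = List.ofFn w := by
  have : pre γ n = List.ofFn fun i : Fin n => γ i := by
    apply List.ext_getElem <;> simp [pre]
  rw [this, List.ofFn_inj, funext_iff]

theorem follows_ofFn {o : V} {σ : V → List E} {n : ℕ} (w : Fin n → E) :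
    (∀ i : Fin n, stackEdge G o σ (i : ℕ) = some (w i)) ↔ Follows G o σ (List.ofFn w) := by
  constructor
  · intro h i hi
    have hi' : i < n := by simpa using hi
    rw [h ⟨i, hi'⟩]
    simp [List.getElem?_ofFn, hi']
  · intro h i
    rw [h i (by simp)]
    simp [List.getElem?_ofFn]

theorem null_congr {α : Type*} [MeasurableSpace α] {μ : Measure α} {N S T : Set α} (hN : μ N = 0)
    (h : ∀ x, x ∉ N → (x ∈ S ↔ x ∈ T)) : μ S = μ T := by
  have key : ∀ S T : Set α, (∀ x, x ∉ N → (x ∈ S ↔ x ∈ T)) → μ S ≤ μ T := by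
    intro S T h
    have : S ⊆ T ∪ N := by
      intro x hx
      by_cases hxN : x ∈ N
      · exact Or.inr hxN
      · exact Or.inl ((h x hxN).1 hx)
    refine (measure_mono this).trans ((measure_union_le _ _).trans ?_)
    rw [hN, add_zero]
  exact le_antisymm (key S T h) (key T S fun x hx => (h x hx).symm)

theorem stack_meas [Countable E] (K : Finset V) (a : K → List E) :
    @MeasurableSet _ (stackMS V E) ((fun (σ : V → List E) (v : K) => σ v) ⁻¹' {a}) := by
  letI : MeasurableSpace (List E) := ⊤
  have hm : @Measurable _ _ (stackMS V E) MeasurableSpace.pi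
      (fun (σ : V → List E) (v : K) => σ v) := by
    unfold stackMS
    exact measurable_pi_lambda _ fun v => measurable_pi_apply _
  haveI : MeasurableSingletonClass (List E) := ⟨fun _ => trivial⟩
  exact hm (measurableSet_singleton a)

theorem stack_valid_null [Countable V] [Countable E] {κ : Measure (E → Bool)}
    {ρ : @Measure (V → List E) (stackMS V E)} (hρ : IsStackLaw G κ ρ) :
    ρ {σ | ¬ ∀ v, ValidAt G v (σ v)} = 0 := by
  letI := stackMS V E
  have hsub : {σ : V → List E | ¬ ∀ v, ValidAt G v (σ v)} ⊆
      ⋃ v : V, ⋃ l : {l // ¬ ValidAt G v l}, {σ | ∀ u ∈ ({v} : Finset V), σ u = l.1} := by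
    intro σ hσ
    simp only [mem_ofPred_eq, not_forall] at hσ
    obtain ⟨v, hv⟩ := hσ
    refine mem_iUnion.2 ⟨v, mem_iUnion.2 ⟨⟨σ v, hv⟩, fun u hu => ?_⟩⟩
    rw [Finset.mem_singleton.1 hu]
  refine measure_mono_null hsub ?_
  refine measure_iUnion_null fun v => measure_iUnion_null fun l => ?_
  rw [hρ.2 {v} fun _ => l.1, if_neg]
  intro h
  exact l.2 (h v (by simp))

end final

/-- A proper Gibbs measure on Eulerian paths from `o` to `∞` on a sourced
Eulerian digraph is the law of the path obtained by: sampling the wired uniform spanning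
in-arboretum, placing its edge at the bottom of the stack at each vertex below an independent
uniform ordering of the remaining outgoing edges, and following the stacks from `o`. -/
theorem stmt17 {V E : Type} [Countable V] [Countable E] [MeasurableSpace E]
    [DiscreteMeasurableSpace E]
    (G : DigraphStruct V E) (o : V) (hG : G.IsSourcedEulerian o)
    (μ : Measure (ℕ → E)) (hμ : ProperGibbs G o μ)
    (κ : Measure (E → Bool)) (hκ : IsWUALaw G κ)
    (ρ : @Measure (V → List E) (stackMS V E)) (hρ : IsStackLaw G κ ρ) :
    ∀ (n : ℕ) (w : Fin n → E),
      μ {γ | ∀ i : Fin n, γ (i : ℕ) = w i} =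
        ρ {σ | ∀ i : Fin n, stackEdge G o σ (i : ℕ) = some (w i)} := by
  classical
  intro n w
  letI := stackMS V E
  have hf := hG.locFin
  have hNμ := eul_compl_null hμ
  have hNρ := stack_valid_null hρ
  have hsrc : ∀ σ : V → List E, (∀ v, ValidAt G v (σ v)) → ∀ v, ∀ e ∈ σ v, G.src e = v :=
    fun σ hσ v e he => ((hσ v).2 e).1 he
  by_cases hpath : ∃ z, IsPathList G o z (List.ofFn w)
  · obtain ⟨z, hz⟩ := hpath
    let K : Finset V := (List.ofFn w).toFinset.image G.src
    have hK : ∀ v, v ∉ K → filt G v (List.ofFn w) = [] := by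
      intro v hv
      rw [List.eq_nil_iff_forall_not_mem]
      intro e he
      rw [mem_filt] at he
      exact hv (Finset.mem_image.2 ⟨e, List.mem_toFinset.2 he.1, he.2⟩)
    have hKall : ∀ σ : V → List E, (∀ v : K, filt G v (List.ofFn w) <+: σ v) →
        ∀ v, filt G v (List.ofFn w) <+: σ v := by
      intro σ h v
      by_cases hv : v ∈ K
      · exact h ⟨v, hv⟩
      · rw [hK v hv]; exact List.nil_prefix
    let C : Set (K → List E) := {a | ∀ v : K, filt G v (List.ofFn w) <+: a v}
    let f : (ℕ → E) → (K → List E) := fun γ v => stk G γ v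
    let g : (V → List E) → (K → List E) := fun σ v => σ v
    have hfm : ∀ a, MeasurableSet (f ⁻¹' {a}) := by
      intro a
      have : f ⁻¹' {a} = ⋂ v : K, {γ : ℕ → E | stk G γ v = a v} := by
        ext γ
        simp only [mem_preimage, mem_singleton_iff, mem_iInter, mem_ofPred_eq, funext_iff, f]
      rw [this]
      exact MeasurableSet.iInter fun v => meas_stk _ _
    have hgm : ∀ a, MeasurableSet (g ⁻¹' {a}) := fun a => stack_meas K a
    have h1 : μ {γ | ∀ i : Fin n, γ (i : ℕ) = w i} = μ (f ⁻¹' C) := by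
      refine null_congr hNμ fun γ hγ => ?_
      have hγ : Eul G o γ := not_not.1 hγ
      change (∀ i : Fin n, γ (i : ℕ) = w i) ↔ ∀ v : K, filt G v (List.ofFn w) <+: stk G γ v
      rw [pre_eq_ofFn]
      constructor
      · intro h v
        rw [← h]
        exact hγ.filt_prefix_stk hf v n
      · intro h
        exact path_eq_of_prefix (stk G γ) (hγ.pre_path n) hz (by rw [pre_length]; simp)
          (fun v => hγ.filt_prefix_stk hf v n) (hKall _ h)
    have h2 : ρ {σ | ∀ i : Fin n, stackEdge G o σ (i : ℕ) = some (w i)} = ρ (g ⁻¹' C) := by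
      refine null_congr hNρ fun σ hσ => ?_
      have hσ : ∀ v, ValidAt G v (σ v) := not_not.1 hσ
      change (∀ i : Fin n, stackEdge G o σ (i : ℕ) = some (w i)) ↔
        ∀ v : K, filt G v (List.ofFn w) <+: σ v
      rw [follows_ofFn]
      constructor
      · intro h v
        rw [(follows_state (hsrc σ hσ) h).2 v]
        exact List.prefix_append _ _
      · intro h
        exact follows_of_prefix (hsrc σ hσ) hz (hKall _ h)
    rw [h1, h2, measure_eq_tsum_fiber μ f hfm, measure_eq_tsum_fiber ρ g hgm]
    refine tsum_congr fun a => ?_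
    by_cases ha : a ∈ C
    · have e1 : f ⁻¹' {a} ∩ f ⁻¹' C = {γ | ∀ v ∈ K, stk G γ v = ext0 K a v} := by
        ext γ
        simp only [mem_inter_iff, mem_preimage, mem_singleton_iff, mem_ofPred_eq]
        constructor
        · rintro ⟨h, -⟩ v hv
          rw [ext0_mem _ hv, ← h]
        · intro h
          have : f γ = a := funext fun v => by
            rw [← ext0_mem a v.2]; exact h v v.2
          exact ⟨this, this ▸ ha⟩
      have e2 : g ⁻¹' {a} ∩ g ⁻¹' C = {σ | ∀ v ∈ K, σ v = ext0 K a v} := by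
        ext σ
        simp only [mem_inter_iff, mem_preimage, mem_singleton_iff, mem_ofPred_eq]
        constructor
        · rintro ⟨h, -⟩ v hv
          rw [ext0_mem _ hv, ← h]
        · intro h
          have : g σ = a := funext fun v => by
            rw [← ext0_mem a v.2]; exact h v v.2
          exact ⟨this, this ▸ ha⟩
      rw [e1, e2]
      have h3 := hρ.2 K (ext0 K a)
      by_cases hval : ∀ v ∈ K, (ext0 K a v).Nodup ∧ ∀ e : E, e ∈ ext0 K a v ↔ G.src e = v
      · rw [if_pos hval] at h3
        exact (stk_law hG hμ hκ K (ext0 K a) hval).trans h3.symm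
      · rw [if_neg hval] at h3
        refine Eq.trans ?_ h3.symm
        refine measure_mono_null ?_ hNμ
        intro γ hγ hE
        exact hval fun v hv => hγ v hv ▸ hE.stk_valid hf v
    · have e1 : f ⁻¹' {a} ∩ f ⁻¹' C = ∅ := by
        rw [Set.eq_empty_iff_forall_notMem]
        rintro γ ⟨h, h'⟩
        exact ha ((show f γ = a from h) ▸ h')
      have e2 : g ⁻¹' {a} ∩ g ⁻¹' C = ∅ := by
        rw [Set.eq_empty_iff_forall_notMem]
        rintro γ ⟨h, h'⟩
        exact ha ((show g γ = a from h) ▸ h')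
      rw [e1, e2, measure_empty, measure_empty]
  · have h1 : μ {γ | ∀ i : Fin n, γ (i : ℕ) = w i} = 0 := by
      refine measure_mono_null ?_ hNμ
      intro γ hγ hE
      exact hpath ⟨_, (pre_eq_ofFn γ w).1 hγ ▸ hE.pre_path n⟩
    have h2 : ρ {σ | ∀ i : Fin n, stackEdge G o σ (i : ℕ) = some (w i)} = 0 := by
      refine measure_mono_null ?_ hNρ
      intro σ hσ hv
      exact hpath ⟨_, (follows_state (hsrc σ hv) ((follows_ofFn w).1 hσ)).1⟩
    rw [h1, h2]

end DF
end

section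
/- Let γ be an infinite transient path in a digraph G, indexed by {0,1,2,…}, and for k ≥ 1 let γ^k denote the path formed by the first k steps of γ. Then the loop-erasure LE(γ^k) converges to LE(γ) as k → ∞, in the sense that for every m ≥ 1 there exists K such that for all k ≥ K, the paths LE(γ^k) and LE(γ) have the same initial segment of length m. -/
open MeasureTheory Filter Set
open scoped ENNReal

namespace DF

/-! ### Sequences over a countable state space -/

variable {S : Type}

/-- The loop-erasure of the first `k` steps of an infinite transient path
converges to the loop-erasure of the whole path: for every `m` there is `K` such that for all
`k ≥ K` the loop-erasure times up to index `m` (and hence the initial segments of length `m` of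
the two loop-erased paths) coincide. -/
theorem stmt18 {V E : Type} (G : DigraphStruct V E) (γ : ℕ → E)
    (hpath : G.IsInfPath γ) (htrans : G.IsTransientPath γ) :
    ∀ m : ℕ, ∃ K : ℕ, ∀ k ≥ K, ∀ i ≤ m,
      leTimesF (fun t => G.src (γ t)) k i = leTimes (fun t => G.src (γ t)) i := by
  intro m
  induction m with
  | zero =>
    refine ⟨0, fun k _ i hi => ?_⟩
    obtain rfl : i = 0 := by omega
    simp only [leTimesF, leTimes]
  | succ m ih =>
    obtain ⟨K, hK⟩ := ih
    obtain ⟨B, hB⟩ :=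
      (htrans (G.src (γ (leTimes (fun t => G.src (γ t)) m)))).bddAbove
    refine ⟨max K B, fun k hk i hi => ?_⟩
    have hkK : K ≤ k := le_trans (le_max_left _ _) hk
    have hkB : B ≤ k := le_trans (le_max_right _ _) hk
    rcases Nat.lt_or_ge m i with h | h
    · obtain rfl : i = m + 1 := by omega
      simp only [leTimesF, leTimes]
      rw [hK k hkK m le_rfl]
      congr 2
      ext t
      simp only [Set.mem_setOf_eq]
      constructor
      · rintro ⟨h1, _, h3⟩
        exact ⟨h1, h3⟩
      · rintro ⟨h1, h3⟩
        exact ⟨h1, le_trans (hB h3) hkB, h3⟩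
    · exact hK k hkK i h

end DF
end

section
/- Let (G,o) be a sourced Eulerian digraph with countable vertex set V, and let μ be a proper Gibbs measure on Eulerian paths from o to ∞ in G. If X is a random path with law μ, then the sequence of vertices (X_0, X_1, X_2, …) visited by X is a partially exchangeable random sequence in V. -/
open MeasureTheory Filter Set
open scoped ENNReal

namespace DF

/-! ### Sequences over a countable state space -/

variable {S : Type}

/-- Equivalent finite sequences have transitions that are permutations of each other. -/
theorem finEquiv_perm {V : Type} {n : ℕ} {x y : ℕ → V} (h : FinEquiv x y n) :
    ∃ σ : Equiv.Perm (Fin n), ∀ i : Fin n,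
      y (σ i : ℕ) = x i ∧ y ((σ i : ℕ) + 1) = x ((i : ℕ) + 1) := by
  have key : ∀ (z : ℕ → V) (c : V × V),
      Nat.card {i : Fin n // (z i, z ((i : ℕ) + 1)) = c} = transCount z n c.1 c.2 := by
    intro z c
    unfold transCount
    rw [← Nat.card_coe_set_eq]
    refine Nat.card_congr
      { toFun := fun i => ⟨i.1, i.1.2, ?_, ?_⟩
        invFun := fun i => ⟨⟨i.1, i.2.1⟩, ?_⟩
        left_inv := fun i => rfl
        right_inv := fun i => rfl }
    · exact congrArg Prod.fst i.2
    · exact congrArg Prod.snd i.2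
    · exact Prod.ext i.2.2.1 i.2.2.2
  have e : ∀ c : V × V, Nonempty ({i : Fin n // (x i, x ((i : ℕ) + 1)) = c} ≃
      {i : Fin n // (y i, y ((i : ℕ) + 1)) = c}) := by
    intro c
    refine Finite.card_eq.1 ?_
    rw [key, key, h.2]
  have e' := fun c => (e c).some
  refine ⟨Equiv.ofFiberEquiv (f := fun i : Fin n => (x i, x ((i : ℕ) + 1)))
    (g := fun i : Fin n => (y i, y ((i : ℕ) + 1))) e', fun i => ?_⟩
  have := Equiv.ofFiberEquiv_map (f := fun i : Fin n => (x i, x ((i : ℕ) + 1)))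
    (g := fun i : Fin n => (y i, y ((i : ℕ) + 1))) e' i
  exact ⟨congrArg Prod.fst this, congrArg Prod.snd this⟩

/-- Equivalent finite sequences have the same final state. -/
theorem finEquiv_last {V : Type} {n : ℕ} {x y : ℕ → V} (h : FinEquiv x y n) : x n = y n := by
  classical
  obtain ⟨σ, hσ⟩ := finEquiv_perm h
  by_contra hne
  let f : V → ℤ := fun v => if v = x n then 1 else 0
  have tel : ∀ z : ℕ → V,
      ∑ i : Fin n, (f (z ((i : ℕ) + 1)) - f (z i)) = f (z n) - f (z 0) := by
    intro z
    rw [Fin.sum_univ_eq_sum_range (fun i => f (z (i + 1)) - f (z i)) n]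
    exact Finset.sum_range_sub (fun i => f (z i)) n
  have heq : ∑ i : Fin n, (f (x ((i : ℕ) + 1)) - f (x i)) =
      ∑ i : Fin n, (f (y ((i : ℕ) + 1)) - f (y i)) := by
    rw [← Equiv.sum_comp σ (fun i : Fin n => f (y ((i : ℕ) + 1)) - f (y i))]
    refine Finset.sum_congr rfl fun i _ => ?_
    rw [(hσ i).1, (hσ i).2]
  rw [tel, tel, h.1] at heq
  have : f (x n) = f (y n) := by linarith
  simp [f, Ne.symm hne] at this

/-- `w` is an injective edge sequence whose vertices are `x 0 = o, x 1, …, x n`. -/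
def GoodFor {V E : Type} (G : DigraphStruct V E) (o : V) (n : ℕ) (x : ℕ → V)
    (w : Fin n → E) : Prop :=
  Function.Injective w ∧ x 0 = o ∧
    ∀ i : Fin n, G.src (w i) = x i ∧ G.dst (w i) = x ((i : ℕ) + 1)

theorem GoodFor.prefixPath {V E : Type} {G : DigraphStruct V E} {o : V} {n : ℕ} {x : ℕ → V}
    {w : Fin n → E} (h : GoodFor G o n x w) : PrefixPath G o w := by
  refine ⟨fun h0 => ?_, fun i hi => ?_⟩
  · rw [(h.2.2 ⟨0, h0⟩).1]; exact h.2.1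
  · rw [(h.2.2 ⟨i, _⟩).2, (h.2.2 ⟨i + 1, hi⟩).1]

/-- The part of the event on which the first `n` edges are `w`. -/
def cylSet {V E : Type} (G : DigraphStruct V E) (n : ℕ) (x : ℕ → V) (w : Fin n → E) :
    Set (ℕ → E) :=
  {γ | (∀ i ≤ n, G.src (γ i) = x i) ∧ ∀ i : Fin n, γ (i : ℕ) = w i}

theorem measurable_coord {E : Type} [MeasurableSpace E] [DiscreteMeasurableSpace E]
    (i : ℕ) (P : E → Prop) : MeasurableSet {γ : ℕ → E | P (γ i)} :=
  measurableSet_preimage (measurable_pi_apply (X := fun _ : ℕ => E) i)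
    (MeasurableSet.of_discrete (s := {e : E | P e}))

theorem measurable_coord_pair {E : Type} [Countable E] [MeasurableSpace E]
    [DiscreteMeasurableSpace E] (i j : ℕ) (P : E × E → Prop) :
    MeasurableSet {γ : ℕ → E | P (γ i, γ j)} :=
  measurableSet_preimage ((measurable_pi_apply (X := fun _ : ℕ => E) i).prodMk
    (measurable_pi_apply (X := fun _ : ℕ => E) j))
    (MeasurableSet.of_discrete (s := {p : E × E | P p}))

theorem measurable_event {V E : Type} [MeasurableSpace E] [DiscreteMeasurableSpace E]
    (G : DigraphStruct V E) (n : ℕ) (x : ℕ → V) :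
    MeasurableSet {γ : ℕ → E | ∀ i ≤ n, G.src (γ i) = x i} := by
  have : {γ : ℕ → E | ∀ i ≤ n, G.src (γ i) = x i} =
      ⋂ i : ℕ, {γ : ℕ → E | i ≤ n → G.src (γ i) = x i} := by
    ext γ
    simp
  rw [this]
  exact MeasurableSet.iInter fun i => measurable_coord i fun e => i ≤ n → G.src e = x i

theorem measure_event_eq_tsum {V E : Type} [Countable E] [MeasurableSpace E]
    [DiscreteMeasurableSpace E] (G : DigraphStruct V E) (μ : Measure (ℕ → E)) (n : ℕ)
    (x : ℕ → V) :
    μ {γ | ∀ i ≤ n, G.src (γ i) = x i} = ∑' w : Fin n → E, μ (cylSet G n x w) := by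
  have hU : {γ : ℕ → E | ∀ i ≤ n, G.src (γ i) = x i} = ⋃ w : Fin n → E, cylSet G n x w := by
    ext γ
    simp only [cylSet, mem_ofPred_eq, mem_iUnion]
    exact ⟨fun h => ⟨fun i => γ i, h, fun _ => rfl⟩, fun ⟨_, h, _⟩ => h⟩
  rw [hU]
  refine measure_iUnion ?_ ?_
  · intro w w' hne
    refine Set.disjoint_left.2 fun γ h h' => hne (funext fun i => ?_)
    rw [← h.2 i, h'.2 i]
  · intro w
    have : cylSet G n x w = {γ : ℕ → E | ∀ i ≤ n, G.src (γ i) = x i} ∩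
        ⋂ i : Fin n, {γ : ℕ → E | γ (i : ℕ) = w i} := by
      ext γ
      simp [cylSet]
    rw [this]
    exact (measurable_event G n x).inter
      (MeasurableSet.iInter fun i => measurable_coord (i : ℕ) fun e => e = w i)

theorem gibbs_ae {V E : Type} [Countable E] [MeasurableSpace E] [DiscreteMeasurableSpace E]
    {G : DigraphStruct V E} {o : V} {μ : Measure (ℕ → E)} (hμ : ProperGibbs G o μ) :
    ∀ᵐ γ ∂μ, (∀ i : ℕ, G.dst (γ i) = G.src (γ (i + 1))) ∧ G.src (γ 0) = o ∧
      Function.Injective γ := by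
  haveI : IsProbabilityMeasure μ := ⟨hμ.1⟩
  have hm : MeasurableSet {γ : ℕ → E | (∀ i : ℕ, G.dst (γ i) = G.src (γ (i + 1))) ∧
      G.src (γ 0) = o ∧ Function.Injective γ} := by
    have : {γ : ℕ → E | (∀ i : ℕ, G.dst (γ i) = G.src (γ (i + 1))) ∧
        G.src (γ 0) = o ∧ Function.Injective γ} =
        (⋂ i : ℕ, {γ : ℕ → E | G.dst (γ i) = G.src (γ (i + 1))}) ∩
        ({γ : ℕ → E | G.src (γ 0) = o} ∩
          ⋂ i : ℕ, ⋂ j : ℕ, {γ : ℕ → E | γ i = γ j → i = j}) := by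
      ext γ
      simp [Function.Injective]
    rw [this]
    refine MeasurableSet.inter ?_ (MeasurableSet.inter ?_ ?_)
    · exact MeasurableSet.iInter fun i =>
        measurable_coord_pair i (i + 1) fun p => G.dst p.1 = G.src p.2
    · exact measurable_coord 0 fun e => G.src e = o
    · exact MeasurableSet.iInter fun i => MeasurableSet.iInter fun j =>
        measurable_coord_pair i j fun p => p.1 = p.2 → i = j
  refine (mem_ae_iff_prob_eq_one hm).2 (le_antisymm prob_le_one ?_)
  rw [← hμ.2.1]
  exact measure_mono fun γ h => ⟨h.1, h.2.1, h.2.2.1⟩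

theorem cylSet_bad {V E : Type} [Countable E] [MeasurableSpace E] [DiscreteMeasurableSpace E]
    {G : DigraphStruct V E} {o : V} {μ : Measure (ℕ → E)} (hμ : ProperGibbs G o μ)
    {n : ℕ} {x : ℕ → V} {w : Fin n → E} (h : ¬ GoodFor G o n x w) :
    μ (cylSet G n x w) = 0 := by
  refine measure_mono_null ?_ (gibbs_ae hμ)
  rintro γ ⟨h1, h2⟩ ⟨h3, h4, h5⟩
  refine h ⟨fun i j hij => ?_, ?_, fun i => ⟨?_, ?_⟩⟩
  · rw [← h2 i, ← h2 j] at hij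
    exact Fin.ext (h5 hij)
  · rw [← h1 0 (Nat.zero_le n), h4]
  · rw [← h2 i, h1 i i.2.le]
  · rw [← h2 i, h3, h1 _ i.2]

theorem cylSet_good {V E : Type} {G : DigraphStruct V E} {o : V}
    {n : ℕ} {x : ℕ → V} {w : Fin n → E} (h : GoodFor G o n x w) :
    cylSet G n x w = {γ | (∀ i : Fin n, γ (i : ℕ) = w i) ∧
      (fun t : ℕ => γ (n + t)) ∈ {δ : ℕ → E | G.src (δ 0) = x n}} := by
  ext γ
  constructor
  · rintro ⟨h1, h2⟩
    exact ⟨h2, h1 n le_rfl⟩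
  · rintro ⟨h2, h1⟩
    refine ⟨fun i hi => ?_, h2⟩
    rcases hi.lt_or_eq with hi | rfl
    · rw [h2 ⟨i, hi⟩, (h.2.2 ⟨i, hi⟩).1]
    · exact h1

/-- The sequence of vertices visited by a random path distributed as a proper
Gibbs measure on Eulerian paths from `o` to `∞` on a sourced Eulerian digraph is a partially
exchangeable random sequence. -/
theorem stmt19 {V E : Type} [Countable V] [Countable E] [MeasurableSpace E]
    [DiscreteMeasurableSpace E]
    (G : DigraphStruct V E) (o : V) (hG : G.IsSourcedEulerian o)
    (μ : Measure (ℕ → E)) (hμ : ProperGibbs G o μ) :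
    ∀ (n : ℕ) (x y : ℕ → V), FinEquiv x y n →
      μ {γ | ∀ i ≤ n, G.src (γ i) = x i} = μ {γ | ∀ i ≤ n, G.src (γ i) = y i} := by
  intro n x y hxy
  obtain ⟨σ, hσ⟩ := finEquiv_perm hxy
  have hlast := finEquiv_last hxy
  rw [measure_event_eq_tsum, measure_event_eq_tsum,
    ← Equiv.tsum_eq (Equiv.arrowCongr σ (Equiv.refl E)) fun w => μ (cylSet G n y w)]
  refine tsum_congr fun w => ?_
  have hw' : (Equiv.arrowCongr σ (Equiv.refl E)) w = w ∘ σ.symm := rfl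
  rw [hw']
  have hiff : GoodFor G o n x w ↔ GoodFor G o n y (w ∘ σ.symm) := by
    constructor
    · rintro ⟨h1, h2, h3⟩
      refine ⟨h1.comp σ.symm.injective, hxy.1 ▸ h2, fun i => ?_⟩
      have := hσ (σ.symm i)
      rw [Equiv.apply_symm_apply] at this
      rw [this.1, this.2]
      exact h3 (σ.symm i)
    · rintro ⟨h1, h2, h3⟩
      refine ⟨?_, hxy.1.trans h2, fun i => ?_⟩
      · have := h1.comp σ.injective
        simpa [Function.comp_assoc] using this
      · have := h3 (σ i)
        rw [(hσ i).1, (hσ i).2] at this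
        simpa using this
  by_cases hg : GoodFor G o n x w
  · have hg' := hiff.1 hg
    rw [cylSet_good hg, cylSet_good hg', ← hlast]
    refine hμ.2.2 n w (w ∘ σ.symm) hg.1 hg'.1 ?_ hg.prefixPath hg'.prefixPath _
    rw [σ.symm.surjective.range_comp]
  · rw [cylSet_bad hμ hg, cylSet_bad hμ fun h => hg (hiff.2 h)]

end DF
end
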